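/- arXiv:2202.00269 — 3 statements merged into one kernel-verified Lean document; each statement's English description precedes it below -/
import Mathlib

section
/- The bivariate generating function D(z,w) = Σ_{n,m≥0} D_{n,m} z^n w^m of the Kirkman–Cayley numbers satisfies the functional equation D = 1 + w·z·D^2/(1 - z·D), i.e., D·(1 - z·D) = (1 - z·D) + w·z·D^2, as formal power series. -/
/-! A combinatorial model of dissections of a convex `N`-gon.
Vertices are `Fin N` in cyclic (convex position) order.  A dissection is
recorded by its set of pairwise non-crossing diagonals; its cells are the
faces of the resulting subdivision. -/

namespace PolygonDissection

/-- The cyclic successor of a vertex of the `N`-gon. -/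
def cyc {N : ℕ} (i : Fin N) : Fin N := ⟨(i.val + 1) % N, Nat.mod_lt _ i.pos⟩

/-- `e` is a side of the convex `N`-gon: a pair of cyclically adjacent vertices. -/
def IsSide (N : ℕ) (e : Finset (Fin N)) : Prop :=
  ∃ i : Fin N, i ≠ cyc i ∧ e = {i, cyc i}

/-- `e` is a diagonal of the convex `N`-gon. -/
def IsDiag (N : ℕ) (e : Finset (Fin N)) : Prop :=
  e.card = 2 ∧ ¬ IsSide N e

/-- Two chords of the convex `N`-gon cross in the interior. -/
def Crosses (N : ℕ) (e f : Finset (Fin N)) : Prop :=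
  ∃ a b c d : Fin N, a < c ∧ c < b ∧ b < d ∧
    ((e = {a, b} ∧ f = {c, d}) ∨ (e = {c, d} ∧ f = {a, b}))

/-- A dissection of the convex `N`-gon: a set of pairwise non-crossing diagonals. -/
def IsDissection (N : ℕ) (S : Finset (Finset (Fin N))) : Prop :=
  (∀ e ∈ S, IsDiag N e) ∧ ∀ e ∈ S, ∀ f ∈ S, ¬ Crosses N e f

/-- `y` is the cyclic successor of `x` among the vertices of `c`. -/
def IsNext {N : ℕ} (c : Finset (Fin N)) (x y : Fin N) : Prop :=
  x ∈ c ∧ y ∈ c ∧ y ≠ x ∧ ∀ z ∈ c, z ≠ x → (y - x).val ≤ (z - x).val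

/-- `c` (a set of polygon vertices) is a cell of the dissection `S`:
each pair of cyclically consecutive vertices of `c` is joined by a side of the
polygon or a diagonal of `S`, and no diagonal of `S` is an interior chord of `c`. -/
def IsCell (N : ℕ) (S : Finset (Finset (Fin N))) (c : Finset (Fin N)) : Prop :=
  3 ≤ c.card ∧
  (∀ x y : Fin N, IsNext c x y → IsSide N {x, y} ∨ {x, y} ∈ S) ∧
  (∀ e ∈ S, e ⊆ c → ∃ x y, e = ({x, y} : Finset (Fin N)) ∧ (IsNext c x y ∨ IsNext c y x))

/-- The number of cells of the dissection `S`. -/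
noncomputable def numCells (N : ℕ) (S : Finset (Finset (Fin N))) : ℕ :=
  {c : Finset (Fin N) | IsCell N S c}.ncard

/-- The quiddity of the dissection `S`: its `i`-th entry is the number of
cells containing the `i`-th vertex. -/
noncomputable def quiddity (N : ℕ) (S : Finset (Finset (Fin N))) (i : Fin N) : ℕ :=
  {c : Finset (Fin N) | IsCell N S c ∧ i ∈ c}.ncard


/-- `Dnm n m` is the number of dissections of a convex `(n+2)`-gon into `m` cells
(by non-crossing diagonals); `Dnm 0 0 = 1` and `Dnm 0 m = 0` for `m > 0`. -/
noncomputable def Dnm (n m : ℕ) : ℕ :=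
  {S : Finset (Finset (Fin (n + 2))) | IsDissection (n + 2) S ∧
      numCells (n + 2) S = m}.ncard

/-- The bivariate generating function `D(z, w) = ∑ Dnm n m * z^n * w^m`,
with `z` the variable `X 0` and `w` the variable `X 1`. -/
noncomputable def Dgf : MvPowerSeries (Fin 2) ℚ :=
  fun d => (Dnm (d 0) (d 1) : ℚ)

open Finset

/-! ## model on natural numbers -/
def NC (S : Finset (ℕ × ℕ)) : Prop :=
  ∀ p ∈ S, ∀ q ∈ S, ¬ (p.1 < q.1 ∧ q.1 < p.2 ∧ p.2 < q.2)

def chords (l r : ℕ) : Finset (ℕ × ℕ) :=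
  (Icc l r ×ˢ Icc l r).filter (fun p => p.1 + 2 ≤ p.2)

lemma mem_chords {l r : ℕ} {p : ℕ × ℕ} :
    p ∈ chords l r ↔ l ≤ p.1 ∧ p.1 + 2 ≤ p.2 ∧ p.2 ≤ r := by
  simp only [chords, mem_filter, mem_product, mem_Icc]; omega

open Classical in
noncomputable def allD (l r : ℕ) : Finset (Finset (ℕ × ℕ)) :=
  (chords l r).powerset.filter NC

lemma mem_allD {l r : ℕ} {S : Finset (ℕ × ℕ)} :
    S ∈ allD l r ↔ (∀ p ∈ S, l ≤ p.1 ∧ p.1 + 2 ≤ p.2 ∧ p.2 ≤ r) ∧ NC S := by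
  simp only [allD, mem_filter, mem_powerset, subset_iff, mem_chords]

noncomputable def dD (l r : ℕ) : Finset (Finset (ℕ × ℕ)) :=
  (allD l r).filter (fun S => l + 2 ≤ r → (l, r) ∈ S)

noncomputable def nD (l r : ℕ) : Finset (Finset (ℕ × ℕ)) :=
  (allD l r).filter (fun S => (l, r) ∉ S)

noncomputable def gf (F : Finset (Finset (ℕ × ℕ))) : PowerSeries ℚ :=
  ∑ S ∈ F, PowerSeries.X ^ S.card

lemma allD_small (l r : ℕ) (h : r < l + 2) : allD l r = {∅} := by
  ext S
  rw [mem_allD, mem_singleton]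
  constructor
  · rintro ⟨h1, -⟩
    rw [eq_empty_iff_forall_notMem]
    intro p hp
    have := h1 p hp
    omega
  · rintro rfl
    simp [NC]

lemma gf_allD_small (l r : ℕ) (h : r < l + 2) : gf (allD l r) = 1 := by
  rw [allD_small l r h]; simp [gf]

lemma gf_dD_small (l r : ℕ) (h : r < l + 2) : gf (dD l r) = 1 := by
  have : dD l r = {∅} := by
    rw [dD, allD_small l r h]
    ext S; simp; omega
  rw [this]; simp [gf]

lemma gf_dD (l r : ℕ) (h : l + 2 ≤ r) : gf (dD l r) = PowerSeries.X * gf (nD l r) := by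
  rw [gf, gf, mul_sum]
  refine sum_bij' (fun S _ => S.erase (l, r)) (fun S _ => insert (l, r) S) ?_ ?_ ?_ ?_ ?_
  · intro S hS
    simp only [dD, nD, mem_filter, mem_allD, NC] at hS ⊢
    refine ⟨⟨fun p hp => hS.1.1 p (mem_of_mem_erase hp), fun p hp q hq => hS.1.2 p (mem_of_mem_erase hp) q (mem_of_mem_erase hq)⟩, by simp⟩
  · intro S hS
    simp only [dD, nD, mem_filter, mem_allD, NC] at hS ⊢
    refine ⟨⟨?_, ?_⟩, by simp⟩
    · intro p hp
      rcases mem_insert.1 hp with rfl | hp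
      · simp; omega
      · exact hS.1.1 p hp
    · intro p hp q hq
      rcases mem_insert.1 hp with rfl | hp <;> rcases mem_insert.1 hq with rfl | hq
      · simp
      · have := hS.1.1 q hq; simp; omega
      · have := hS.1.1 p hp; simp; omega
      · exact hS.1.2 p hp q hq
  · intro S hS
    simp only [dD, mem_filter] at hS
    exact insert_erase (hS.2 h)
  · intro S hS
    simp only [nD, mem_filter] at hS
    exact erase_insert hS.2
  · intro S hS
    simp only [dD, mem_filter] at hS
    rw [← pow_succ', card_erase_add_one (hS.2 h)]

lemma gf_allD (l r : ℕ) (h : l + 2 ≤ r) : gf (allD l r) = gf (nD l r) + gf (dD l r) := by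
  have := sum_filter_add_sum_filter_not (allD l r) (fun S => (l, r) ∈ S)
    (fun S => (PowerSeries.X : PowerSeries ℚ) ^ S.card)
  simp only [gf, nD, dD, h, true_implies]
  rw [← this, add_comm]

noncomputable def kk (l : ℕ) (S : Finset (ℕ × ℕ)) : ℕ :=
  (S.filter (fun p => p.1 = l)).sup Prod.snd ⊔ (l + 1)

lemma le_kk {l b : ℕ} {S : Finset (ℕ × ℕ)} (h : (l, b) ∈ S) : b ≤ kk l S := by
  refine le_trans ?_ le_sup_left
  exact le_sup (f := Prod.snd) (b := (l, b)) (by simp [h])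

lemma kk_mem {l : ℕ} {S : Finset (ℕ × ℕ)} (h : l + 2 ≤ kk l S) : (l, kk l S) ∈ S := by
  have h1 : kk l S = (S.filter (fun p => p.1 = l)).sup Prod.snd := by
    unfold kk at h ⊢
    simp only [le_sup_iff] at h
    apply sup_of_le_left
    omega
  have hne : (S.filter (fun p => p.1 = l)).Nonempty := by
    rw [nonempty_iff_ne_empty]
    intro h0
    rw [h1, h0] at h; simp at h
  obtain ⟨p, hp, hp2⟩ := exists_mem_eq_sup _ hne Prod.snd
  rw [← h1] at hp2
  rw [hp2]
  rw [mem_filter] at hp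
  rw [← hp.2]; exact hp.1

lemma kk_eq {l k : ℕ} {S : Finset (ℕ × ℕ)} (h1 : l + 1 ≤ k) (h2 : l + 2 ≤ k → (l, k) ∈ S)
    (h3 : ∀ b, (l, b) ∈ S → b ≤ k) : kk l S = k := by
  apply le_antisymm
  · by_cases h : l + 2 ≤ kk l S
    · exact h3 _ (kk_mem h)
    · omega
  · by_cases h : l + 2 ≤ k
    · exact le_kk (h2 h)
    · have : l + 1 ≤ kk l S := le_sup_right
      omega

lemma gf_nD (l r : ℕ) (h : l + 2 ≤ r) :
    gf (nD l r) = ∑ k ∈ Ioo l r, gf (dD l k) * gf (allD k r) := by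
  have hm : ∀ S ∈ nD l r, kk l S ∈ Ioo l r := by
    intro S hS
    simp only [nD, mem_filter, mem_allD] at hS
    have h1 : l + 1 ≤ kk l S := le_sup_right
    rw [mem_Ioo]
    refine ⟨h1, ?_⟩
    by_contra hc
    have h2 := kk_mem (l := l) (S := S) (by omega)
    have h3 := hS.1.1 _ h2
    have h4 : kk l S = r := by simp at h3; omega
    rw [h4] at h2
    exact hS.2 h2
  rw [gf, ← sum_fiberwise_of_maps_to hm]
  refine sum_congr rfl fun k hk => ?_
  rw [mem_Ioo] at hk
  rw [gf, gf, sum_mul_sum, ← sum_product']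
  symm
  refine sum_bij' (fun P _ => P.1 ∪ P.2)
    (fun S _ => (S.filter (fun p => p.2 ≤ k), S.filter (fun p => k ≤ p.1))) ?_ ?_ ?_ ?_ ?_
  · rintro ⟨A, B⟩ hP
    simp only [mem_product, dD, nD, mem_filter, mem_allD] at hP ⊢
    obtain ⟨⟨⟨hA, hAn⟩, hAk⟩, hB, hBn⟩ := hP
    refine ⟨⟨⟨?_, ?_⟩, ?_⟩, ?_⟩
    · intro p hp
      rcases mem_union.1 hp with hp | hp
      · have := hA p hp; omega
      · have := hB p hp; omega
    · intro p hp q hq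
      rcases mem_union.1 hp with hp | hp <;> rcases mem_union.1 hq with hq | hq
      · exact hAn p hp q hq
      · have := hA p hp; have := hB q hq; omega
      · have := hB p hp; have := hA q hq; omega
      · exact hBn p hp q hq
    · intro hp
      rcases mem_union.1 hp with hp | hp
      · have := hA _ hp; simp at this; omega
      · have := hB _ hp; simp at this; omega
    · apply kk_eq (by omega)
      · intro hh; exact mem_union_left _ (hAk hh)
      · intro b hp
        rcases mem_union.1 hp with hp | hp
        · have := hA _ hp; simp at this; omega
        · have := hB _ hp; simp at this; omega
  · intro S hS
    simp only [mem_product, dD, nD, mem_filter, mem_allD] at hS ⊢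
    obtain ⟨⟨⟨hA, hn⟩, hnot⟩, hkk⟩ := hS
    refine ⟨⟨⟨?_, ?_⟩, ?_⟩, ?_, ?_⟩
    · rintro p ⟨hp, hpk⟩; have := hA p hp; omega
    · intro p hp q hq; exact hn p (mem_filter.1 hp).1 q (mem_filter.1 hq).1
    · intro hh; exact ⟨by rw [← hkk] at hh ⊢; exact kk_mem hh, le_rfl⟩
    · rintro p ⟨hp, hpk⟩; have := hA p hp; omega
    · intro p hp q hq; exact hn p (mem_filter.1 hp).1 q (mem_filter.1 hq).1
  · rintro ⟨A, B⟩ hP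
    simp only [mem_product, dD, mem_filter, mem_allD] at hP
    obtain ⟨⟨⟨hA, hAn⟩, hAk⟩, hB, hBn⟩ := hP
    ext p
    · simp only [mem_filter, mem_union]
      constructor
      · rintro ⟨hp | hp, hk⟩
        · exact hp
        · have := hB p hp; omega
      · intro hp; have := hA p hp; exact ⟨Or.inl hp, by omega⟩
    · simp only [mem_filter, mem_union]
      constructor
      · rintro ⟨hp | hp, hk⟩
        · have := hA p hp; omega
        · exact hp
      · intro hp; have := hB p hp; exact ⟨Or.inr hp, by omega⟩
  · intro S hS
    simp only [nD, mem_filter, mem_allD] at hS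
    obtain ⟨⟨⟨hA, hn⟩, hnot⟩, hkk⟩ := hS
    ext p
    simp only [mem_filter, mem_union]
    constructor
    · tauto
    · intro hp
      by_cases h1 : p.2 ≤ k
      · exact Or.inl ⟨hp, h1⟩
      · refine Or.inr ⟨hp, ?_⟩
        by_contra h2
        have h3 := hA p hp
        by_cases h4 : p.1 = l
        · have : (l, p.2) ∈ S := by rw [← h4]; exact hp
          have := le_kk this
          omega
        · have h5 := kk_mem (l := l) (S := S) (by omega)
          have := hn _ h5 p hp
          simp only at this; omega
  · rintro ⟨A, B⟩ hP
    simp only [mem_product, dD, mem_filter, mem_allD] at hP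
    obtain ⟨⟨⟨hA, hAn⟩, hAk⟩, hB, hBn⟩ := hP
    rw [← pow_add, card_union_of_disjoint]
    rw [disjoint_left]
    intro p hp hp'
    have := hA p hp; have := hB p hp'; omega

noncomputable def Dn (n : ℕ) : PowerSeries ℚ := gf (dD 0 (n + 1))
noncomputable def Gn (n : ℕ) : PowerSeries ℚ := gf (allD 0 (n + 1))

lemma shift (n : ℕ) : ∀ l, gf (dD l (l + n + 1)) = Dn n ∧ gf (allD l (l + n + 1)) = Gn n := by
  induction n using Nat.strong_induction_on with
  | _ n ih =>
    intro l
    rcases Nat.eq_zero_or_pos n with rfl | hn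
    · rw [Dn, Gn, gf_dD_small _ _ (by omega), gf_dD_small _ _ (by omega),
        gf_allD_small _ _ (by omega), gf_allD_small _ _ (by omega)]
      simp
    · have key : ∀ l, gf (nD l (l + n + 1)) = ∑ i ∈ range n, Dn i * Gn (n - 1 - i) := by
        intro l
        rw [gf_nD _ _ (by omega)]
        symm
        refine sum_bij' (fun i _ => l + i + 1) (fun k _ => k - l - 1) ?_ ?_ ?_ ?_ ?_
        · intro i hi; simp at hi ⊢; omega
        · intro i hi; simp at hi ⊢; omega
        · intro i hi; show l + i + 1 - l - 1 = i; omega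
        · intro i hi; simp at hi ⊢; omega
        · intro i hi
          simp at hi
          rw [(ih i hi l).1, ← (ih (n - 1 - i) (by omega) (l + i + 1)).2]
          congr 3; omega
      have k0 := key 0
      rw [zero_add] at k0
      rw [Dn, Gn, gf_allD _ _ (by omega), gf_allD _ _ (by omega), gf_dD _ _ (by omega),
        gf_dD _ _ (by omega), key, k0]
      simp

lemma Dn_rec (n : ℕ) : Dn (n + 1) = PowerSeries.X * ∑ p ∈ antidiagonal n, Dn p.1 * Gn p.2 := by
  rw [Dn, gf_dD _ _ (by omega), gf_nD _ _ (by omega)]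
  congr 1
  rw [Nat.sum_antidiagonal_eq_sum_range_succ_mk]
  symm
  refine sum_bij' (fun i _ => i + 1) (fun k _ => k - 1) ?_ ?_ ?_ ?_ ?_
  · intro i hi; simp at hi ⊢; omega
  · intro i hi; simp at hi ⊢; omega
  · intro i hi; simp
  · intro i hi; simp at hi ⊢; omega
  · intro i hi
    simp at hi
    have := (shift (n - i) (i + 1)).2
    rw [show i + 1 + (n - i) + 1 = n + 1 + 1 by omega] at this
    simp only
    rw [this, Dn]

lemma Gn_succ (n : ℕ) : PowerSeries.X * Gn (n + 1) = (1 + PowerSeries.X) * Dn (n + 1) := by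
  rw [Gn, Dn, gf_allD _ _ (by omega), gf_dD _ _ (by omega)]; ring

lemma Dn_zero : Dn 0 = 1 := gf_dD_small _ _ (by omega)
lemma Gn_zero : Gn 0 = 1 := gf_allD_small _ _ (by omega)

noncomputable def DD : PowerSeries (PowerSeries ℚ) := PowerSeries.mk Dn
noncomputable def GG : PowerSeries (PowerSeries ℚ) := PowerSeries.mk Gn

lemma DD_eq1 : DD = 1 + PowerSeries.C PowerSeries.X * (PowerSeries.X * (DD * GG)) := by
  ext1 n
  rcases n with _ | n
  · simp [DD, Dn_zero]
  · rw [map_add, PowerSeries.coeff_C_mul, PowerSeries.coeff_succ_X_mul, PowerSeries.coeff_mul]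
    simp only [DD, GG, PowerSeries.coeff_mk, PowerSeries.coeff_one]
    rw [Dn_rec]; simp

lemma GG_eq : PowerSeries.C PowerSeries.X * GG =
    (1 + PowerSeries.C PowerSeries.X) * (DD - 1) + PowerSeries.C PowerSeries.X := by
  ext1 n
  rw [show (1 + PowerSeries.C (PowerSeries.X : PowerSeries ℚ)) = PowerSeries.C (1 + PowerSeries.X) by simp,
   map_add, PowerSeries.coeff_C_mul, PowerSeries.coeff_C_mul]
  rcases n with _ | n
  · simp [DD, GG, Dn_zero, Gn_zero]
  · simp only [DD, GG, map_sub, PowerSeries.coeff_mk, PowerSeries.coeff_one, PowerSeries.coeff_C]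
    rw [Gn_succ]; simp

lemma DD_eq : DD * (1 - PowerSeries.X * DD) = (1 - PowerSeries.X * DD) +
    PowerSeries.C PowerSeries.X * PowerSeries.X * DD ^ 2 := by
  linear_combination DD_eq1 + PowerSeries.X * DD * GG_eq

/-! ## transfer of power series -/
noncomputable def ex (n m : ℕ) : Fin 2 →₀ ℕ := Finsupp.single 0 n + Finsupp.single 1 m

@[simp] lemma ex_zero (n m : ℕ) : ex n m 0 = n := by simp [ex]
@[simp] lemma ex_one (n m : ℕ) : ex n m 1 = m := by simp [ex]
lemma ex_eta (d : Fin 2 →₀ ℕ) : ex (d 0) (d 1) = d := by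
  ext i; fin_cases i <;> simp

noncomputable def Phi (f : MvPowerSeries (Fin 2) ℚ) : PowerSeries (PowerSeries ℚ) :=
  PowerSeries.mk fun n => PowerSeries.mk fun m => MvPowerSeries.coeff (ex n m) f

lemma coeff_Phi (f) (n m : ℕ) : PowerSeries.coeff m (PowerSeries.coeff n (Phi f)) =
  MvPowerSeries.coeff (ex n m) f := by simp [Phi]

lemma Phi_inj {f g} (h : Phi f = Phi g) : f = g := by
  ext d
  rw [← ex_eta d, ← coeff_Phi, ← coeff_Phi, h]

lemma Phi_add (f g) : Phi (f + g) = Phi f + Phi g := by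
  ext n m; simp [coeff_Phi]
lemma Phi_sub (f g) : Phi (f - g) = Phi f - Phi g := by
  ext n m; simp [coeff_Phi]

lemma Phi_mul (f g) : Phi (f * g) = Phi f * Phi g := by
  ext n m
  rw [coeff_Phi, MvPowerSeries.coeff_mul, PowerSeries.coeff_mul, map_sum]
  simp_rw [PowerSeries.coeff_mul, coeff_Phi]
  rw [← sum_product']
  refine sum_bij' (fun p _ => ((p.1 0, p.2 0), (p.1 1, p.2 1)))
    (fun q _ => (ex q.1.1 q.2.1, ex q.1.2 q.2.2)) ?_ ?_ ?_ ?_ ?_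
  · rintro ⟨a, b⟩ hp
    rw [HasAntidiagonal.mem_antidiagonal] at hp
    simp only [mem_product, HasAntidiagonal.mem_antidiagonal] at hp ⊢
    constructor
    · rw [← Finsupp.add_apply, hp]; simp
    · rw [← Finsupp.add_apply, hp]; simp
  · rintro ⟨⟨a, b⟩, ⟨c, d⟩⟩ hp
    simp only [mem_product, HasAntidiagonal.mem_antidiagonal] at hp ⊢
    obtain ⟨rfl, rfl⟩ := hp
    ext i; fin_cases i <;> simp
  · rintro ⟨a, b⟩ hp; simp [ex_eta]
  · rintro ⟨⟨a, b⟩, ⟨c, d⟩⟩ hp; simp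
  · rintro ⟨a, b⟩ hp; simp [ex_eta]

lemma ex_eq_iff (n m : ℕ) (d : Fin 2 →₀ ℕ) : ex n m = d ↔ n = d 0 ∧ m = d 1 := by
  constructor
  · rintro rfl; simp
  · rintro ⟨rfl, rfl⟩; exact ex_eta d

lemma Phi_one : Phi 1 = 1 := by
  ext n m
  rw [coeff_Phi, MvPowerSeries.coeff_one, PowerSeries.coeff_one]
  simp only [ex_eq_iff]
  by_cases h : n = 0 <;> by_cases h' : m = 0 <;> simp [h, h', PowerSeries.coeff_one]

lemma Phi_X0 : Phi (MvPowerSeries.X 0) = PowerSeries.X := by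
  ext n m
  rw [coeff_Phi, MvPowerSeries.coeff_X, PowerSeries.coeff_X]
  simp only [ex_eq_iff]
  by_cases h : n = 1 <;> by_cases h' : m = 0 <;> simp [h, h', PowerSeries.coeff_one]

lemma Phi_X1 : Phi (MvPowerSeries.X 1) = PowerSeries.C PowerSeries.X := by
  ext n m
  rw [coeff_Phi, MvPowerSeries.coeff_X, PowerSeries.coeff_C]
  simp only [ex_eq_iff]
  by_cases h : n = 0 <;> by_cases h' : m = 1 <;> simp [h, h', PowerSeries.coeff_X]

/-! ## cells -/
lemma pair_inj {N : ℕ} {a b c d : Fin N} (h1 : a < b) (h2 : c < d)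
    (h : ({a, b} : Finset (Fin N)) = {c, d}) : a = c ∧ b = d := by
  have ha : a ∈ ({c, d} : Finset (Fin N)) := by rw [← h]; simp
  have hb : b ∈ ({c, d} : Finset (Fin N)) := by rw [← h]; simp
  have hc : c ∈ ({a, b} : Finset (Fin N)) := by rw [h]; simp
  have hd : d ∈ ({a, b} : Finset (Fin N)) := by rw [h]; simp
  simp only [mem_insert, mem_singleton, Fin.ext_iff, Fin.lt_def] at *
  omega

lemma val_sub_cases {N : ℕ} (x y : Fin N) :
    (x ≤ y ∧ (y - x).val = y.val - x.val) ∨ (y < x ∧ (y - x).val = N + y.val - x.val) := by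
  rcases le_or_gt x y with h | h
  · exact Or.inl ⟨h, Fin.coe_sub_iff_le.2 h⟩
  · exact Or.inr ⟨h, Fin.coe_sub_iff_lt.2 h⟩

lemma isNext_lt {N : ℕ} {c : Finset (Fin N)} {x y : Fin N} (h : x < y) :
    IsNext c x y ↔ x ∈ c ∧ y ∈ c ∧ ∀ z ∈ c, ¬ (x < z ∧ z < y) := by
  unfold IsNext
  refine and_congr_right fun hx => and_congr_right fun hy => ?_
  constructor
  · rintro ⟨-, h1⟩ z hz ⟨h2, h3⟩
    have := h1 z hz h2.ne'
    have a1 := val_sub_cases x y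
    have a2 := val_sub_cases x z
    simp only [Fin.lt_def, Fin.le_def] at *
    omega
  · intro h1
    refine ⟨h.ne', fun z hz hzx => ?_⟩
    have := h1 z hz
    have a1 := val_sub_cases x y
    have a2 := val_sub_cases x z
    simp only [Fin.lt_def, Fin.le_def, Ne, Fin.ext_iff] at *
    omega

lemma isNext_gt {N : ℕ} {c : Finset (Fin N)} {x y : Fin N} (h : x < y) :
    IsNext c y x ↔ x ∈ c ∧ y ∈ c ∧ ∀ z ∈ c, x ≤ z ∧ z ≤ y := by
  unfold IsNext
  constructor
  · rintro ⟨hy, hx, -, h1⟩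
    refine ⟨hx, hy, fun z hz => ?_⟩
    by_cases hzy : z = y
    · subst hzy; exact ⟨h.le, le_rfl⟩
    have := h1 z hz hzy
    have a1 := val_sub_cases y x
    have a2 := val_sub_cases y z
    simp only [Fin.lt_def, Fin.le_def, Fin.ext_iff] at *
    omega
  · rintro ⟨hx, hy, h1⟩
    refine ⟨hy, hx, h.ne, fun z hz hzx => ?_⟩
    have := h1 z hz
    have a1 := val_sub_cases y x
    have a2 := val_sub_cases y z
    simp only [Fin.lt_def, Fin.le_def, Ne, Fin.ext_iff] at *
    omega

lemma isSide_iff {N : ℕ} {x y : Fin N} (h : x < y) :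
    IsSide N {x, y} ↔ y.val = x.val + 1 ∨ (x.val = 0 ∧ y.val + 1 = N) := by
  have hyN := y.2
  have hxy : x.val < y.val := h
  constructor
  · rintro ⟨i, hi, he⟩
    have hv : (cyc i).val = (i.val + 1) % N := rfl
    have hiN := i.2
    rcases lt_or_gt_of_ne hi with h2 | h2
    · obtain ⟨rfl, rfl⟩ := pair_inj h h2 he
      by_cases h3 : x.val + 1 < N
      · rw [Nat.mod_eq_of_lt h3] at hv; exact Or.inl hv
      · have : x.val + 1 = N := by omega
        omega
    · rw [pair_comm i] at he
      obtain ⟨rfl, rfl⟩ := pair_inj h h2 he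
      by_cases h3 : y.val + 1 < N
      · rw [Nat.mod_eq_of_lt h3] at hv; omega
      · have h4 : y.val + 1 = N := by omega
        rw [h4, Nat.mod_self] at hv
        exact Or.inr ⟨hv, h4⟩
  · rintro (h1 | ⟨h1, h2⟩)
    · have : cyc x = y := by
        apply Fin.ext
        change (x.val + 1) % N = y.val
        rw [← h1, Nat.mod_eq_of_lt hyN]
      exact ⟨x, by rw [this]; exact h.ne, by rw [this]⟩
    · have : cyc y = x := by
        apply Fin.ext
        change (y.val + 1) % N = x.val
        rw [h2, Nat.mod_self, h1]
      exact ⟨y, by rw [this]; exact h.ne', by rw [this, pair_comm]⟩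

def K {N : ℕ} (S : Finset (Finset (Fin N))) (a b : Fin N) : Prop :=
  a.val + 2 ≤ b.val ∧ ({a, b} ∈ S ∨ (a.val = 0 ∧ b.val + 1 = N))

lemma K_lt {N : ℕ} {S : Finset (Finset (Fin N))} {a b : Fin N} (h : K S a b) : a < b := by
  have := h.1; rw [Fin.lt_def]; omega

lemma diag_pair {N : ℕ} {S : Finset (Finset (Fin N))} (hS : IsDissection N S) {a b : Fin N}
    (hab : a < b) (h : {a, b} ∈ S) : a.val + 2 ≤ b.val ∧ ¬ (a.val = 0 ∧ b.val + 1 = N) := by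
  have h1 := (hS.1 _ h).2
  rw [isSide_iff hab] at h1
  rw [Fin.lt_def] at hab
  omega

lemma exists_pair {N : ℕ} {S : Finset (Finset (Fin N))} (hS : IsDissection N S)
    {e : Finset (Fin N)} (he : e ∈ S) : ∃ a b, a < b ∧ e = {a, b} := by
  obtain ⟨a, b, hab, rfl⟩ := card_eq_two.1 (hS.1 e he).1
  rcases lt_or_gt_of_ne hab with h | h
  · exact ⟨a, b, h, rfl⟩
  · exact ⟨b, a, h, pair_comm _ _⟩

lemma K_of_mem {N : ℕ} {S : Finset (Finset (Fin N))} (hS : IsDissection N S) {a b : Fin N}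
    (hab : a < b) (h : {a, b} ∈ S) : K S a b := ⟨(diag_pair hS hab h).1, Or.inl h⟩

lemma side_or_iff {N : ℕ} {S : Finset (Finset (Fin N))} (hS : IsDissection N S) {a b : Fin N}
    (hab : a < b) : (IsSide N {a, b} ∨ {a, b} ∈ S) ↔ (b.val = a.val + 1 ∨ K S a b) := by
  rw [isSide_iff hab]
  constructor
  · rintro ((h | h) | h)
    · exact Or.inl h
    · by_cases h' : b.val = a.val + 1
      · exact Or.inl h'
      · rw [Fin.lt_def] at hab
        exact Or.inr ⟨by omega, Or.inr h⟩
    · exact Or.inr (K_of_mem hS hab h)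
  · rintro (h | ⟨_, h | h⟩) <;> tauto

lemma K_nc {N : ℕ} {S : Finset (Finset (Fin N))} (hS : IsDissection N S) {a b c d : Fin N}
    (h1 : K S a b) (h2 : K S c d) : ¬ (a < c ∧ c < b ∧ b < d) := by
  rintro ⟨h3, h4, h5⟩
  have := d.2
  rcases h1.2 with h1 | h1
  · rcases h2.2 with h2 | h2
    · exact hS.2 _ h1 _ h2 ⟨a, b, c, d, h3, h4, h5, Or.inl ⟨rfl, rfl⟩⟩
    · rw [Fin.lt_def] at *; omega
  · rw [Fin.lt_def] at *; omega

/-- linear reformulation of cells -/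
def IsCell' {N : ℕ} (S : Finset (Finset (Fin N))) (c : Finset (Fin N)) : Prop :=
  3 ≤ c.card ∧
  (∀ x ∈ c, ∀ y ∈ c, x < y → (∀ z ∈ c, ¬ (x < z ∧ z < y)) → y.val = x.val + 1 ∨ K S x y) ∧
  (∀ x ∈ c, ∀ y ∈ c, x < y → (∀ z ∈ c, x ≤ z ∧ z ≤ y) → K S x y) ∧
  (∀ x ∈ c, ∀ y ∈ c, K S x y → (∀ z ∈ c, ¬ (x < z ∧ z < y)) ∨ (∀ z ∈ c, x ≤ z ∧ z ≤ y))

lemma not_adj {N : ℕ} {c : Finset (Fin N)} (hc : 3 ≤ c.card) {x y : Fin N}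
    (h : ∀ z ∈ c, x ≤ z ∧ z ≤ y) : ∃ z ∈ c, x < z ∧ z < y := by
  by_contra! hcon
  have : c ⊆ {x, y} := by
    intro z hz
    have h1 := h z hz
    have h2 := hcon z hz
    simp only [mem_insert, mem_singleton, Fin.lt_def, Fin.le_def, Fin.ext_iff] at *
    omega
  have := card_le_card this
  have := card_le_two (a := x) (b := y)
  omega

lemma isCell_iff {N : ℕ} {S : Finset (Finset (Fin N))} (hS : IsDissection N S)
    (c : Finset (Fin N)) : IsCell N S c ↔ IsCell' S c := by
  unfold IsCell IsCell'
  refine and_congr_right fun hc => ?_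
  constructor
  · rintro ⟨h1, h2⟩
    refine ⟨?_, ?_, ?_⟩
    · intro x hx y hy hxy hz
      exact (side_or_iff hS hxy).1 (h1 x y ((isNext_lt hxy).2 ⟨hx, hy, hz⟩))
    · intro x hx y hy hxy hz
      have h3 := h1 y x ((isNext_gt hxy).2 ⟨hx, hy, hz⟩)
      rw [pair_comm, side_or_iff hS hxy] at h3
      refine h3.resolve_left fun h4 => ?_
      obtain ⟨z, hz, hz2⟩ := not_adj hc hz
      rw [Fin.lt_def, Fin.lt_def] at hz2
      omega
    · intro x hx y hy hK
      have hxy := K_lt hK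
      rcases hK.2 with h3 | h3
      · obtain ⟨u, v, he, huv⟩ := h2 _ h3 (by
          intro z hz; simp only [mem_insert, mem_singleton] at hz
          rcases hz with rfl | rfl <;> assumption)
        have hn : IsNext c x y ∨ IsNext c y x := by
          rcases lt_trichotomy u v with h | h | h
          · obtain ⟨rfl, rfl⟩ := pair_inj hxy h he; exact huv
          · subst h
            have := huv.elim (fun h => h.2.2.1) (fun h => h.2.2.1)
            exact absurd rfl this
          · rw [pair_comm u] at he
            obtain ⟨rfl, rfl⟩ := pair_inj hxy h he; exact huv.symm
        rcases hn with hn | hn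
        · exact Or.inl ((isNext_lt hxy).1 hn).2.2
        · exact Or.inr ((isNext_gt hxy).1 hn).2.2
      · right
        intro z hz
        have := z.2
        simp only [Fin.le_def]; omega
  · rintro ⟨h1, h2, h3⟩
    constructor
    · intro x y hn
      rcases lt_or_gt_of_ne hn.2.2.1 with h | h
      · rw [pair_comm, side_or_iff hS h]
        obtain ⟨a, b, d⟩ := (isNext_gt h).1 hn
        exact Or.inr (h2 _ a _ b h d)
      · rw [side_or_iff hS h]
        obtain ⟨a, b, d⟩ := (isNext_lt h).1 hn
        exact h1 _ a _ b h d
    · intro e he hec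
      obtain ⟨a, b, hab, rfl⟩ := exists_pair hS he
      have ha : a ∈ c := hec (by simp)
      have hb : b ∈ c := hec (by simp)
      refine ⟨a, b, rfl, ?_⟩
      rw [isNext_lt hab, isNext_gt hab]
      rcases h3 a ha b hb (K_of_mem hS hab he) with h | h
      · exact Or.inl ⟨ha, hb, h⟩
      · exact Or.inr ⟨ha, hb, h⟩

open Classical in
noncomputable def cellOf {N : ℕ} (S : Finset (Finset (Fin N))) (a b : Fin N) : Finset (Fin N) :=
  univ.filter fun v => a ≤ v ∧ v ≤ b ∧
    ∀ p q, K S p q → a ≤ p → q ≤ b → ¬ (p = a ∧ q = b) → ¬ (p < v ∧ v < q)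

lemma mem_cellOf {N : ℕ} {S : Finset (Finset (Fin N))} {a b v : Fin N} :
    v ∈ cellOf S a b ↔ a ≤ v ∧ v ≤ b ∧
    ∀ p q, K S p q → a ≤ p → q ≤ b → ¬ (p = a ∧ q = b) → ¬ (p < v ∧ v < q) := by
  simp [cellOf]

lemma left_mem {N : ℕ} {S : Finset (Finset (Fin N))} {a b : Fin N} (h : a ≤ b) :
    a ∈ cellOf S a b := by
  rw [mem_cellOf]
  exact ⟨le_rfl, h, fun p q _ h1 _ _ h2 => absurd h2.1 (not_lt.2 h1)⟩

lemma right_mem {N : ℕ} {S : Finset (Finset (Fin N))} {a b : Fin N} (h : a ≤ b) :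
    b ∈ cellOf S a b := by
  rw [mem_cellOf]
  exact ⟨h, le_rfl, fun p q _ _ h1 _ h2 => absurd h2.2 (not_lt.2 h1)⟩

/-- consecutive vertices -/
lemma cellOf_consec {N : ℕ} {S : Finset (Finset (Fin N))} (hS : IsDissection N S) {a b x y : Fin N}
    (hx : x ∈ cellOf S a b) (hy : y ∈ cellOf S a b) (hxy : x < y)
    (hz : ∀ z ∈ cellOf S a b, ¬ (x < z ∧ z < y)) :
    y.val = x.val + 1 ∨ (K S x y ∧ ¬ (x = a ∧ y = b)) := by
  classical
  by_cases h1 : y.val = x.val + 1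
  · exact Or.inl h1
  right
  have hx' := mem_cellOf.1 hx
  have hy' := mem_cellOf.1 hy
  have hlt : x.val + 1 < y.val := by rw [Fin.lt_def] at hxy; omega
  let v : Fin N := ⟨x.val + 1, by omega⟩
  have hv : v ∉ cellOf S a b := fun h => hz v h ⟨by simp [Fin.lt_def, v], by simpa [Fin.lt_def, v] using hlt⟩
  rw [mem_cellOf] at hv
  push Not at hv
  have hvx : v.val = x.val + 1 := rfl
  obtain ⟨p, q, hpq, hap, hqb, hne, hpv, hvq⟩ := hv
    (by simp only [Fin.le_def] at *; omega) (by simp only [Fin.le_def] at *; omega)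
  have hpx : p = x := by
    have := hx'.2.2 p q hpq hap hqb (by tauto)
    simp only [Fin.lt_def, Fin.ext_iff] at *; omega
  subst hpx
  -- maximal q
  let Q : Finset (Fin N) := univ.filter fun q => K S p q ∧ q ≤ b ∧ ¬ (p = a ∧ q = b)
  have hQ : Q.Nonempty := ⟨q, by simp only [Q, mem_filter, mem_univ, true_and]; tauto⟩
  obtain ⟨m, hm, hmax⟩ := Q.exists_maximal hQ
  have hmax' : ∀ t, K S p t → t ≤ b → ¬ (p = a ∧ t = b) → t ≤ m := by
    intro t h1 h2 h3
    have : t ∈ Q := by simp only [Q, mem_filter, mem_univ, true_and]; tauto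
    rcases le_total t m with h | h
    · exact h
    · exact hmax this h
  simp only [Q, mem_filter, mem_univ, true_and] at hm
  obtain ⟨hm1, hm2, hm3⟩ := hm
  have hpm := K_lt hm1
  have hmc : m ∈ cellOf S a b := by
    rw [mem_cellOf]
    refine ⟨hap.trans hpm.le, hm2, ?_⟩
    rintro p' q' hk h1 h2 h3 ⟨h4, h5⟩
    rcases lt_trichotomy p' p with h | h | h
    · exact hx'.2.2 p' q' hk h1 h2 h3 ⟨h, hpm.trans h5⟩
    · subst h
      exact absurd h5 (not_lt.2 (hmax' q' hk h2 h3))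
    · exact K_nc hS hm1 hk ⟨h, h4, h5⟩
  have hmy : m = y := by
    have g1 := hz m hmc
    have g2 := hy'.2.2 p m hm1 hap hm2 hm3
    simp only [Fin.lt_def, Fin.ext_iff] at *; omega
  subst hmy
  exact ⟨hm1, hm3⟩

lemma cellOf_isCell {N : ℕ} {S : Finset (Finset (Fin N))} (hS : IsDissection N S) {a b : Fin N}
    (h : K S a b) : IsCell' S (cellOf S a b) := by
  have hab := K_lt h
  have ha := left_mem (S := S) hab.le
  have hb := right_mem (S := S) hab.le
  refine ⟨?_, ?_, ?_, ?_⟩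
  · have : ∃ z ∈ cellOf S a b, a < z ∧ z < b := by
      by_contra! hcon
      have := cellOf_consec hS ha hb hab (fun z hz h => absurd h.2 (not_lt.2 (hcon z hz h.1)))
      have := h.1
      simp at *; omega
    obtain ⟨z, hz, h1, h2⟩ := this
    have : ({a, z, b} : Finset (Fin N)) ⊆ cellOf S a b := by
      intro t ht; simp only [mem_insert, mem_singleton] at ht
      rcases ht with rfl | rfl | rfl <;> assumption
    rw [← card_eq_three.2 ⟨a, z, b, h1.ne, hab.ne, h2.ne, rfl⟩]
    exact card_le_card this
  · intro x hx y hy hxy hz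
    have := cellOf_consec hS hx hy hxy hz
    tauto
  · intro x hx y hy hxy hz
    have h1 := hz a ha
    have h2 := hz b hb
    have hx' := mem_cellOf.1 hx
    have hy' := mem_cellOf.1 hy
    rw [le_antisymm h1.1 hx'.1, le_antisymm hy'.2.1 h2.2]
    exact h
  · intro x hx y hy hk
    have hx' := mem_cellOf.1 hx
    have hy' := mem_cellOf.1 hy
    by_cases hh : x = a ∧ y = b
    · obtain ⟨rfl, rfl⟩ := hh
      right
      intro z hz
      have := mem_cellOf.1 hz
      exact ⟨this.1, this.2.1⟩
    · left
      intro z hz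
      exact (mem_cellOf.1 hz).2.2 x y hk hx'.1 hy'.2.1 hh

/-- a vertex in the range but outside `c` lies between two consecutive vertices of `c` -/
lemma gap {N : ℕ} {c : Finset (Fin N)} {a b v : Fin N} (ha : a ∈ c) (hb : b ∈ c)
    (hv : v ∉ c) (h1 : a ≤ v) (h2 : v ≤ b) :
    ∃ x ∈ c, ∃ y ∈ c, x < v ∧ v < y ∧ ∀ z ∈ c, ¬ (x < z ∧ z < y) := by
  have hav : a < v := lt_of_le_of_ne h1 (by rintro rfl; exact hv ha)
  have hvb : v < b := lt_of_le_of_ne h2 (by rintro rfl; exact hv hb)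
  have n1 : (c.filter (· < v)).Nonempty := ⟨a, by simp [ha, hav]⟩
  have n2 : (c.filter (v < ·)).Nonempty := ⟨b, by simp [hb, hvb]⟩
  have m1 := max'_mem _ n1
  have m2 := min'_mem _ n2
  rw [mem_filter] at m1 m2
  refine ⟨_, m1.1, _, m2.1, m1.2, m2.2, ?_⟩
  rintro z hz ⟨h3, h4⟩
  rcases lt_trichotomy z v with h | h | h
  · exact absurd h3 (not_lt.2 (le_max' _ _ (by simp [hz, h])))
  · subst h; exact hv hz
  · exact absurd h4 (not_lt.2 (min'_le _ _ (by simp [hz, h])))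

lemma isCell_eq {N : ℕ} {S : Finset (Finset (Fin N))} (hS : IsDissection N S)
    {c : Finset (Fin N)} (hc : IsCell' S c) : ∃ a b, K S a b ∧ cellOf S a b = c := by
  obtain ⟨h0, h1, h2, h3⟩ := hc
  have hne : c.Nonempty := card_pos.1 (by omega)
  have ha := min'_mem c hne
  have hb := max'_mem c hne
  have hr : ∀ z ∈ c, c.min' hne ≤ z ∧ z ≤ c.max' hne := fun z hz => ⟨min'_le _ _ hz, le_max' _ _ hz⟩
  generalize c.min' hne = a at *
  generalize c.max' hne = b at *
  obtain ⟨z0, hz0, hz1, hz2⟩ := not_adj h0 hr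
  refine ⟨a, b, h2 a ha b hb (hz1.trans hz2) hr, ?_⟩
  have hK : ∀ {x y v : Fin N}, x ∈ c → y ∈ c → x < v → v < y → (∀ z ∈ c, ¬ (x < z ∧ z < y)) → K S x y := by
    intro x y v hx hy hxv hvy hz
    refine (h1 x hx y hy (hxv.trans hvy) hz).resolve_left ?_
    simp only [Fin.lt_def] at hxv hvy; omega
  ext v
  constructor
  · intro hv
    rw [mem_cellOf] at hv
    by_contra hvc
    obtain ⟨x, hx, y, hy, hxv, hvy, hz⟩ := gap ha hb hvc hv.1 hv.2.1
    refine hv.2.2 x y (hK hx hy hxv hvy hz) (hr x hx).1 (hr y hy).2 ?_ ⟨hxv, hvy⟩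
    rintro ⟨rfl, rfl⟩
    exact hz z0 hz0 ⟨hz1, hz2⟩
  · intro hv
    rw [mem_cellOf]
    refine ⟨(hr v hv).1, (hr v hv).2, ?_⟩
    rintro p q hpq hap hqb hne' ⟨hpv, hvq⟩
    have hp : p ∈ c := by
      by_contra hpc
      obtain ⟨x, hx, y, hy, hxp, hpy, hz⟩ := gap ha hb hpc hap (hpv.le.trans (hr v hv).2)
      have hyv : y ≤ v := by
        by_contra hlt
        exact hz v hv ⟨hxp.trans hpv, not_le.1 hlt⟩
      exact K_nc hS (hK hx hy hxp hpy hz) hpq ⟨hxp, hpy, hyv.trans_lt hvq⟩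
    have hq : q ∈ c := by
      by_contra hqc
      obtain ⟨x, hx, y, hy, hxq, hqy, hz⟩ := gap ha hb hqc ((hr v hv).1.trans hvq.le) hqb
      have hxv : v ≤ x := by
        by_contra hlt
        exact hz v hv ⟨not_le.1 hlt, hvq.trans hqy⟩
      exact K_nc hS hpq (hK hx hy hxq hqy hz) ⟨hpv.trans_le hxv, hxq, hqy⟩
    rcases h3 p hp q hq hpq with h | h
    · exact h v hv ⟨hpv, hvq⟩
    · exact hne' ⟨le_antisymm (h a ha).1 hap, le_antisymm hqb (h b hb).2⟩

lemma numCells_eq {N : ℕ} {S : Finset (Finset (Fin N))} (hS : IsDissection N S) :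
    numCells N S = {p : Fin N × Fin N | K S p.1 p.2}.ncard := by
  have : {c : Finset (Fin N) | IsCell N S c} =
      (fun p : Fin N × Fin N => cellOf S p.1 p.2) '' {p | K S p.1 p.2} := by
    ext c
    simp only [Set.mem_setOf_eq, Set.mem_image, Prod.exists, isCell_iff hS]
    constructor
    · exact isCell_eq hS
    · rintro ⟨a, b, h, rfl⟩
      exact cellOf_isCell hS h
  rw [numCells, this, Set.ncard_image_of_injOn]
  rintro ⟨a, b⟩ h ⟨a', b'⟩ h' he
  simp only [Set.mem_setOf_eq] at h h' he
  have e1 := left_mem (S := S) (K_lt h).le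
  have e2 := right_mem (S := S) (K_lt h).le
  have e3 := left_mem (S := S) (K_lt h').le
  have e4 := right_mem (S := S) (K_lt h').le
  rw [he, mem_cellOf] at e1 e2
  rw [← he, mem_cellOf] at e3 e4
  rw [le_antisymm e3.1 e1.1, le_antisymm e2.2.1 e4.2.1]

/-! ## comparison of the models -/
open Classical in
noncomputable def TT {N : ℕ} (S : Finset (Finset (Fin N))) : Finset (ℕ × ℕ) :=
  (univ.filter fun p : Fin N × Fin N => K S p.1 p.2).map
    ⟨fun p => (p.1.val, p.2.val), fun p q h => by
      simp only [Prod.mk.injEq] at h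
      exact Prod.ext (Fin.ext h.1) (Fin.ext h.2)⟩

lemma mem_TT {N : ℕ} {S : Finset (Finset (Fin N))} {a b : Fin N} :
    (a.val, b.val) ∈ TT S ↔ K S a b := by
  constructor
  · intro h
    simp only [TT, mem_map, mem_filter, mem_univ, true_and, Prod.exists] at h
    obtain ⟨a', b', h1, h2⟩ := h
    change (a'.val, b'.val) = (a.val, b.val) at h2
    rw [Prod.mk.injEq, Fin.val_inj, Fin.val_inj] at h2
    rw [← h2.1, ← h2.2]; exact h1
  · intro h
    simp only [TT, mem_map, mem_filter, mem_univ, true_and, Prod.exists]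
    exact ⟨a, b, h, rfl⟩

lemma mem_TT' {N : ℕ} {S : Finset (Finset (Fin N))} {p : ℕ × ℕ} (h : p ∈ TT S) :
    ∃ a b : Fin N, p = (a.val, b.val) ∧ K S a b := by
  simp only [TT, mem_map, mem_filter, mem_univ, true_and, Prod.exists,
    Function.Embedding.coeFn_mk] at h
  obtain ⟨a, b, h1, h2⟩ := h
  exact ⟨a, b, h2.symm, h1⟩

lemma card_TT {N : ℕ} {S : Finset (Finset (Fin N))} (hS : IsDissection N S) :
    (TT S).card = numCells N S := by
  classical
  rw [numCells_eq hS, TT, card_map, ← Set.ncard_coe_finset]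
  congr 1
  ext p; simp

lemma TT_mem_dD {n : ℕ} {S : Finset (Finset (Fin (n + 2)))} (hS : IsDissection (n + 2) S) :
    TT S ∈ dD 0 (n + 1) := by
  simp only [dD, mem_filter, mem_allD, NC]
  refine ⟨⟨?_, ?_⟩, ?_⟩
  · intro p hp
    obtain ⟨a, b, rfl, h⟩ := mem_TT' hp
    have := h.1
    simp only; omega
  · intro p hp q hq
    obtain ⟨a, b, rfl, h⟩ := mem_TT' hp
    obtain ⟨a', b', rfl, h'⟩ := mem_TT' hq
    exact K_nc hS h h'
  · intro h
    exact (mem_TT (a := (0 : Fin (n + 2))) (b := Fin.last (n + 1))).2 ⟨by simpa using h, Or.inr (by simp)⟩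

lemma TT_inj {N : ℕ} {S T : Finset (Finset (Fin N))} (hS : IsDissection N S)
    (hT : IsDissection N T) (h : TT S = TT T) : S ⊆ T := by
  intro e he
  obtain ⟨a, b, hab, rfl⟩ := exists_pair hS he
  have h1 : K T a b := by rw [← mem_TT, ← h, mem_TT]; exact K_of_mem hS hab he
  exact h1.2.resolve_right (diag_pair hS hab he).2

lemma TT_surj {n : ℕ} {T : Finset (ℕ × ℕ)} (hT : T ∈ dD 0 (n + 1)) :
    ∃ S : Finset (Finset (Fin (n + 2))), IsDissection (n + 2) S ∧ TT S = T := by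
  classical
  simp only [dD, mem_filter, mem_allD, NC] at hT
  obtain ⟨⟨h1, h2⟩, h3⟩ := hT
  let S : Finset (Finset (Fin (n + 2))) := univ.filter fun e =>
    ∃ a b : Fin (n + 2), a < b ∧ e = {a, b} ∧ (a.val, b.val) ∈ T ∧ ¬ (a.val = 0 ∧ b.val = n + 1)
  have hmem : ∀ a b : Fin (n + 2), a < b →
      ({a, b} ∈ S ↔ (a.val, b.val) ∈ T ∧ ¬ (a.val = 0 ∧ b.val = n + 1)) := by
    intro a b hab
    simp only [S, mem_filter, mem_univ, true_and]
    constructor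
    · rintro ⟨a', b', hab', he, h⟩
      obtain ⟨rfl, rfl⟩ := pair_inj hab hab' he
      exact h
    · intro h; exact ⟨a, b, hab, rfl, h⟩
  refine ⟨S, ⟨?_, ?_⟩, ?_⟩
  · intro e he
    simp only [S, mem_filter, mem_univ, true_and] at he
    obtain ⟨a, b, hab, rfl, hm, hn⟩ := he
    refine ⟨card_pair hab.ne, ?_⟩
    rw [isSide_iff hab]
    have := h1 _ hm
    simp only at this
    omega
  · rintro e he f hf ⟨a, b, c, d, hac, hcb, hbd, h | h⟩
    · obtain ⟨rfl, rfl⟩ := h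
      exact h2 _ ((hmem _ _ (hac.trans hcb)).1 he).1 _ ((hmem _ _ (hcb.trans hbd)).1 hf).1 ⟨hac, hcb, hbd⟩
    · obtain ⟨rfl, rfl⟩ := h
      exact h2 _ ((hmem _ _ (hac.trans hcb)).1 hf).1 _ ((hmem _ _ (hcb.trans hbd)).1 he).1 ⟨hac, hcb, hbd⟩
  · have key : ∀ a b : Fin (n + 2), K S a b ↔ (a.val, b.val) ∈ T := by
      intro a b
      constructor
      · intro hk
        have hab := K_lt hk
        rcases hk.2 with h | h
        · exact ((hmem a b hab).1 h).1
        · have hb : b.val = n + 1 := by omega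
          rw [h.1, hb]; exact h3 (by have := hk.1; omega)
      · intro h
        have h4 := h1 _ h
        simp only at h4
        have hab : a < b := by rw [Fin.lt_def]; omega
        refine ⟨h4.2.1, ?_⟩
        by_cases h5 : a.val = 0 ∧ b.val = n + 1
        · right; omega
        · left; exact (hmem a b hab).2 ⟨h, h5⟩
    ext ⟨p, q⟩
    constructor
    · intro h
      obtain ⟨a, b, he, hk⟩ := mem_TT' h
      rw [he]; exact (key a b).1 hk
    · intro h
      have h4 := h1 _ h
      simp only at h4
      exact (mem_TT (a := (⟨p, by omega⟩ : Fin (n + 2))) (b := ⟨q, by omega⟩)).2 ((key _ _).2 h)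

lemma Dnm_eq (n m : ℕ) : (Dnm n m : ℚ) = PowerSeries.coeff m (Dn n) := by
  have h1 : Dnm n m = ((dD 0 (n + 1)).filter (fun T => T.card = m)).card := by
    rw [Dnm, ← Set.ncard_coe_finset]
    refine Set.ncard_congr (fun S _ => TT S) ?_ ?_ ?_
    · rintro S ⟨hS, rfl⟩
      simp [TT_mem_dD hS, card_TT hS]
    · rintro S T ⟨hS, _⟩ ⟨hT, _⟩ h
      exact Subset.antisymm (TT_inj hS hT h) (TT_inj hT hS h.symm)
    · intro T hT
      rw [mem_coe, mem_filter] at hT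
      obtain ⟨S, hS, rfl⟩ := TT_surj hT.1
      exact ⟨S, ⟨hS, by rw [← card_TT hS]; exact hT.2⟩, rfl⟩
  rw [h1, Dn, gf, map_sum, card_filter]
  simp only [PowerSeries.coeff_X_pow]
  push_cast
  exact sum_congr rfl fun T _ => by simp [eq_comm]

lemma Phi_Dgf : Phi Dgf = DD := by
  ext n m
  rw [coeff_Phi, DD, PowerSeries.coeff_mk, ← Dnm_eq]
  change (Dnm (ex n m 0) (ex n m 1) : ℚ) = _
  simp

/-- The Kirkman–Cayley generating function satisfies the functional equation
`D = 1 + w z D^2 / (1 - z D)`, i.e. `D (1 - z D) = (1 - z D) + w z D^2`. -/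
theorem dissection_gf_functional_equation :
    Dgf * (1 - MvPowerSeries.X (0 : Fin 2) * Dgf) =
      (1 - MvPowerSeries.X (0 : Fin 2) * Dgf) +
        MvPowerSeries.X (1 : Fin 2) * MvPowerSeries.X (0 : Fin 2) * Dgf ^ 2 := by
  apply Phi_inj
  simp only [pow_two, Phi_mul, Phi_add, Phi_sub, Phi_one, Phi_X0, Phi_X1, Phi_Dgf]
  rw [← pow_two]
  exact DD_eq

end PolygonDissection
end

section
/- A dissection of a convex polygon in which all cells have the same number of vertices is uniquely determined by its quiddity: if two such dissections of the N-gon (with all cells of equal size) have the same quiddity, they are equal. -/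
/-! A combinatorial model of dissections of a convex `N`-gon.
Vertices are `Fin N` in cyclic (convex position) order.  A dissection is
recorded by its set of pairwise non-crossing diagonals; its cells are the
faces of the resulting subdivision. -/

namespace PolygonDissection

section aux

variable {N : ℕ}

def pos (o z : Fin N) : ℕ := (z - o).val

lemma sub_val_eq (a b : Fin N) :
    (a - b).val = if b.val ≤ a.val then a.val - b.val else N + a.val - b.val := by
  have ha := a.isLt
  have hb := b.isLt
  rw [Fin.sub_def]
  simp only
  split_ifs with h
  · rw [show N - b.val + a.val = (a.val - b.val) + N by omega, Nat.add_mod_right,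
      Nat.mod_eq_of_lt (by omega)]
  · rw [Nat.mod_eq_of_lt (by omega)]; omega

lemma pos_lt (o z : Fin N) : pos o z < N := (z - o).isLt

lemma pos_self (o : Fin N) : pos o o = 0 := by
  unfold pos; rw [sub_val_eq]; simp

lemma pos_inj {o u v : Fin N} (h : pos o u = pos o v) : u = v := by
  unfold pos at h
  rw [sub_val_eq, sub_val_eq] at h
  have := u.isLt
  have := v.isLt
  have := o.isLt
  apply Fin.ext
  split_ifs at h <;> omega

lemma pos_ne {o u v : Fin N} (h : u ≠ v) : pos o u ≠ pos o v := fun h' => h (pos_inj h')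

lemma pos_surj (o : Fin N) (n : ℕ) (hn : n < N) : ∃ z, pos o z = n := by
  have ho := o.isLt
  by_cases h : o.val + n < N
  · refine ⟨⟨o.val + n, h⟩, ?_⟩
    unfold pos; rw [sub_val_eq]; simp
  · refine ⟨⟨o.val + n - N, by omega⟩, ?_⟩
    unfold pos; rw [sub_val_eq]; simp only
    split_ifs <;> omega

lemma sub_pos (o u v : Fin N) :
    (v - u).val = if pos o u ≤ pos o v then pos o v - pos o u else N + pos o v - pos o u := by
  unfold pos
  rw [sub_val_eq v u, sub_val_eq u o, sub_val_eq v o]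
  have := u.isLt
  have := v.isLt
  have := o.isLt
  split_ifs <;> omega

lemma cyc_iff (hN : 2 ≤ N) (x y : Fin N) : y = cyc x ↔ (y - x).val = 1 := by
  have hx := x.isLt
  have hy := y.isLt
  rw [sub_val_eq, Fin.ext_iff]
  unfold cyc
  simp only
  by_cases h : x.val + 1 < N
  · rw [Nat.mod_eq_of_lt h]; split_ifs <;> omega
  · have : x.val + 1 = N := by omega
    rw [this, Nat.mod_self]; split_ifs <;> omega

lemma pair_eq {u v a b : Fin N} (h : ({u, v} : Finset (Fin N)) = {a, b}) :
    (u = a ∧ v = b) ∨ (u = b ∧ v = a) := by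
  have h1 : u ∈ ({a, b} : Finset (Fin N)) := by rw [← h]; simp
  have h2 : v ∈ ({a, b} : Finset (Fin N)) := by rw [← h]; simp
  have h3 : a ∈ ({u, v} : Finset (Fin N)) := by rw [h]; simp
  have h4 : b ∈ ({u, v} : Finset (Fin N)) := by rw [h]; simp
  simp only [Finset.mem_insert, Finset.mem_singleton] at h1 h2 h3 h4
  grind

lemma side_iff (hN : 2 ≤ N) (u v : Fin N) :
    IsSide N {u, v} ↔ (v - u).val = 1 ∨ (u - v).val = 1 := by
  constructor
  · rintro ⟨i, -, h⟩
    rcases pair_eq h with ⟨rfl, h2⟩ | ⟨h2, rfl⟩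
    · left; exact (cyc_iff hN _ _).1 h2
    · right; exact (cyc_iff hN _ _).1 h2
  · have key : ∀ u v : Fin N, (v - u).val = 1 → IsSide N {u, v} := by
      intro u v h
      have h' := (cyc_iff hN _ _).2 h
      refine ⟨u, ?_, by rw [h']⟩
      rw [← h']; rintro rfl
      rw [sub_val_eq] at h; simp at h
    rintro (h | h)
    · exact key _ _ h
    · rw [Finset.pair_comm]; exact key _ _ h

lemma side_pos (hN : 2 ≤ N) (o : Fin N) {u v : Fin N} (huv : pos o u < pos o v) :
    IsSide N {u, v} ↔ pos o v = pos o u + 1 ∨ (pos o u = 0 ∧ pos o v = N - 1) := by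
  rw [side_iff hN, sub_pos o u v, sub_pos o v u]
  have := pos_lt o u
  have := pos_lt o v
  split_ifs <;> omega

lemma nocross {S : Finset (Finset (Fin N))} (hS : IsDissection N S) (o : Fin N)
    {u v w z : Fin N} (h1 : {u, v} ∈ S) (h2 : {w, z} ∈ S)
    (a : pos o u < pos o w) (b : pos o w < pos o v) (c : pos o v < pos o z) : False := by
  have key : (u < w ∧ w < v ∧ v < z) ∨ (w < v ∧ v < z ∧ z < u) ∨ (v < z ∧ z < u ∧ u < w)
      ∨ (z < u ∧ u < w ∧ w < v) := by
    unfold pos at a b c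
    rw [sub_val_eq, sub_val_eq] at a b c
    have := u.isLt
    have := v.isLt
    have := w.isLt
    have := z.isLt
    have := o.isLt
    simp only [Fin.lt_def]
    split_ifs at a b c <;> omega
  rcases key with ⟨x, y, t⟩ | ⟨x, y, t⟩ | ⟨x, y, t⟩ | ⟨x, y, t⟩
  · exact hS.2 _ h1 _ h2 ⟨u, v, w, z, x, y, t, Or.inl ⟨rfl, rfl⟩⟩
  · exact hS.2 _ h1 _ h2 ⟨w, z, v, u, x, y, t, Or.inr ⟨Finset.pair_comm _ _, rfl⟩⟩
  · exact hS.2 _ h1 _ h2 ⟨v, u, z, w, x, y, t, Or.inl ⟨Finset.pair_comm _ _, Finset.pair_comm _ _⟩⟩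
  · exact hS.2 _ h1 _ h2 ⟨z, w, u, v, x, y, t, Or.inr ⟨rfl, Finset.pair_comm _ _⟩⟩

lemma next_lt {c : Finset (Fin N)} {u v : Fin N} (o : Fin N) (h : IsNext c u v)
    (huv : pos o u < pos o v) : ∀ w ∈ c, pos o w ≤ pos o u ∨ pos o v ≤ pos o w := by
  intro w hw
  by_contra hc
  have hne : w ≠ u := by rintro rfl; omega
  have := h.2.2.2 w hw hne
  rw [sub_pos o, sub_pos o] at this
  have := pos_lt o w
  have := pos_lt o v
  split_ifs at * <;> omega

lemma next_gt {c : Finset (Fin N)} {u v : Fin N} (o : Fin N) (h : IsNext c u v)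
    (huv : pos o v < pos o u) : ∀ w ∈ c, pos o v ≤ pos o w ∧ pos o w ≤ pos o u := by
  intro w hw
  by_cases hne : w = u
  · subst hne; omega
  have h1 := h.2.2.2 w hw hne
  have h2 := pos_ne (o := o) hne
  rw [sub_pos o, sub_pos o] at h1
  have := pos_lt o w
  have := pos_lt o v
  have := pos_lt o u
  split_ifs at * <;> omega

lemma next_of_lt {c : Finset (Fin N)} {u v : Fin N} (o : Fin N) (hu : u ∈ c) (hv : v ∈ c)
    (huv : pos o u < pos o v) (h : ∀ w ∈ c, pos o w ≤ pos o u ∨ pos o v ≤ pos o w) :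
    IsNext c u v := by
  refine ⟨hu, hv, by rintro rfl; omega, ?_⟩
  intro w hw hne
  have h1 := h w hw
  have h2 := pos_ne (o := o) hne
  rw [sub_pos o, sub_pos o]
  have := pos_lt o w
  have := pos_lt o v
  have := pos_lt o u
  split_ifs at * <;> omega

lemma next_of_gt {c : Finset (Fin N)} {u v : Fin N} (o : Fin N) (hu : u ∈ c) (hv : v ∈ c)
    (huv : pos o v < pos o u) (h : ∀ w ∈ c, pos o v ≤ pos o w ∧ pos o w ≤ pos o u) :
    IsNext c u v := by
  refine ⟨hu, hv, by rintro rfl; omega, ?_⟩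
  intro w hw hne
  have h1 := h w hw
  have h2 := pos_ne (o := o) hne
  rw [sub_pos o, sub_pos o]
  have := pos_lt o w
  have := pos_lt o v
  have := pos_lt o u
  split_ifs at * <;> omega

/-- two mutually consecutive vertices exhaust the set -/
lemma next_next {c : Finset (Fin N)} {u v : Fin N} (h : IsNext c u v) (h' : IsNext c v u) :
    c.card ≤ 2 := by
  have : c ⊆ {u, v} := by
    intro w hw
    have h0 := pos_self u
    have hp : pos u u < pos u v := by
      have := pos_ne (o := u) h.2.2.1
      omega
    have h1 := next_lt u h hp w hw
    have h2 := next_gt u h' hp w hw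
    simp only [Finset.mem_insert, Finset.mem_singleton]
    rcases h1 with h1 | h1
    · left; apply pos_inj (o := u); omega
    · right; apply pos_inj (o := u); omega
  exact (Finset.card_le_card this).trans Finset.card_le_two

lemma gap_s7 {c : Finset (Fin N)} {z w1 w2 : Fin N} (o : Fin N) (hz : z ∉ c) (h1 : w1 ∈ c)
    (h2 : w2 ∈ c) (l1 : pos o w1 ≤ pos o z) (l2 : pos o z ≤ pos o w2) :
    ∃ s t, IsNext c s t ∧ pos o s < pos o z ∧ pos o z < pos o t := by
  obtain ⟨s, hs, hs'⟩ := Finset.exists_max_image (c.filter (fun w => pos o w ≤ pos o z)) (pos o)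
    ⟨w1, by simp [h1, l1]⟩
  obtain ⟨t, ht, ht'⟩ := Finset.exists_min_image (c.filter (fun w => pos o z ≤ pos o w)) (pos o)
    ⟨w2, by simp [h2, l2]⟩
  simp only [Finset.mem_filter] at hs ht hs' ht'
  have e1 : pos o s ≠ pos o z := pos_ne (by rintro rfl; exact hz hs.1)
  have e2 : pos o t ≠ pos o z := pos_ne (by rintro rfl; exact hz ht.1)
  refine ⟨s, t, next_of_lt o hs.1 ht.1 (by omega) ?_, by omega, by omega⟩
  intro w hw
  by_cases hwz : pos o w ≤ pos o z
  · left; exact hs' w ⟨hw, hwz⟩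
  · right; exact ht' w ⟨hw, by omega⟩

lemma cell_two {S : Finset (Finset (Fin N))} {c : Finset (Fin N)} (hc : IsCell N S c) : 3 ≤ N := by
  have := Finset.card_le_univ c
  have h := hc.1
  simp at this
  omega

lemma cell_gap {S : Finset (Finset (Fin N))} {c : Finset (Fin N)} (hc : IsCell N S c)
    {z w1 w2 : Fin N} (o : Fin N) (hz : z ∉ c) (h1 : w1 ∈ c)
    (h2 : w2 ∈ c) (l1 : pos o w1 ≤ pos o z) (l2 : pos o z ≤ pos o w2) :
    ∃ s t, IsNext c s t ∧ pos o s < pos o z ∧ pos o z < pos o t ∧ {s, t} ∈ S := by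
  obtain ⟨s, t, hst, a, b⟩ := gap_s7 o hz h1 h2 l1 l2
  refine ⟨s, t, hst, a, b, ?_⟩
  rcases hc.2.1 s t hst with h | h
  · exfalso
    have hN := cell_two hc
    rw [side_pos (by omega) o (by omega)] at h
    rcases h with h | ⟨h, h'⟩
    · omega
    · have : IsNext c t s := by
        refine next_of_gt o hst.2.1 hst.1 (by omega) ?_
        intro w hw
        have := pos_lt o w
        omega
      have := next_next hst this
      have := hc.1
      omega
  · exact h

lemma capture {S : Finset (Finset (Fin N))} (hS : IsDissection N S) {c : Finset (Fin N)}
    (hc : IsCell N S c) (o : Fin N) {z s t w w' : Fin N} (hz : z ∈ c) (hst : {s, t} ∈ S)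
    (a : pos o s < pos o z) (b : pos o z < pos o t) (hw : w ∈ c) (hw' : w' ∈ c)
    (lw : pos o w ≤ pos o s) (lw' : pos o t ≤ pos o w') :
    ∀ q ∈ c, pos o s ≤ pos o q ∧ pos o q ≤ pos o t := by
  have hs : s ∈ c := by
    by_contra hs
    obtain ⟨p, r, hpr, l1, l2, hm⟩ := cell_gap hc o hs hw hz lw a.le
    have := next_lt o hpr (by omega) z hz
    exact nocross hS o hm hst l1 l2 (by omega)
  have ht : t ∈ c := by
    by_contra ht
    obtain ⟨p, r, hpr, l1, l2, hm⟩ := cell_gap hc o ht hz hw' b.le lw'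
    have := next_lt o hpr (by omega) z hz
    exact nocross hS o hst hm (by omega) l1 l2
  obtain ⟨x, y, he, hxy⟩ := hc.2.2 _ hst (by
    intro q hq
    simp only [Finset.mem_insert, Finset.mem_singleton] at hq
    rcases hq with rfl | rfl <;> assumption)
  have : IsNext c s t ∨ IsNext c t s := by
    rcases pair_eq he with ⟨rfl, rfl⟩ | ⟨rfl, rfl⟩
    · exact hxy
    · exact hxy.symm
  rcases this with h | h
  · have := next_lt o h (by omega) z hz
    omega
  · exact next_gt o h (by omega)

lemma cell_sub {S : Finset (Finset (Fin N))} (hS : IsDissection N S) {c c' : Finset (Fin N)}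
    (hc : IsCell N S c) (hc' : IsCell N S c') {x y : Fin N} (h : IsNext c x y)
    (h' : IsNext c' x y) : c ⊆ c' := by
  intro z hz
  by_contra hz'
  have h0 := pos_self y
  have hp : pos y y < pos y x := by
    have := pos_ne (o := y) h.2.2.1
    omega
  have hb := next_gt y h hp
  obtain ⟨s, t, hst, l1, l2, hm⟩ := cell_gap hc' y hz' h'.2.1 h'.1 (hb z hz).1 (hb z hz).2
  have hb' := next_gt y h' hp
  have hcap := capture hS hc y hz hm l1 l2 h.2.1 h.1 (hb' s hst.1).1 (hb' t hst.2.1).2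
  have e1 : s = y := by
    apply pos_inj (o := y)
    have := hcap y h.2.1
    omega
  have e2 : t = x := by
    apply pos_inj (o := y)
    have := hcap x h.1
    have := hb' t hst.2.1
    omega
  subst e1 e2
  have := next_next h' hst
  have := hc'.1
  omega

lemma exists_next {c : Finset (Fin N)} (hc : 3 ≤ c.card) {x : Fin N} (hx : x ∈ c) :
    ∃ y, IsNext c x y := by
  obtain ⟨y, hy, hy'⟩ := Finset.exists_min_image (c.erase x) (pos x) (by
    rw [← Finset.card_pos, Finset.card_erase_of_mem hx]; omega)
  simp only [Finset.mem_erase] at hy hy'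
  exact ⟨y, hx, hy.2, hy.1, fun z hz hne => hy' z ⟨hne, hz⟩⟩

lemma next_unique {c : Finset (Fin N)} {x y y' : Fin N} (h : IsNext c x y) (h' : IsNext c x y') :
    y = y' := by
  have h1 := h.2.2.2 y' h'.2.1 h'.2.2.1
  have h2 := h'.2.2.2 y h.2.1 h.2.2.1
  exact pos_inj (o := x) (le_antisymm h1 h2)

/-- forward neighbours -/
def nb (S : Finset (Finset (Fin N))) (x : Fin N) : Set (Fin N) := {y | y = cyc x ∨ {x, y} ∈ S}

lemma next_nb {S : Finset (Finset (Fin N))} {c : Finset (Fin N)}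
    (hc : IsCell N S c) {x y : Fin N} (h : IsNext c x y) : y ∈ nb S x := by
  have hN := cell_two hc
  rcases hc.2.1 x y h with hs | hs
  · rw [side_iff (by omega)] at hs
    rcases hs with hs | hs
    · left; rwa [cyc_iff (by omega)]
    · exfalso
      have : IsNext c y x := by
        refine ⟨h.2.1, h.1, h.2.2.1.symm, ?_⟩
        intro z hz hne
        rw [hs]
        have h0 := pos_self y
        have := pos_ne (o := y) hne
        unfold pos at this h0
        omega
      have := next_next h this
      have := hc.1
      omega
  · right; exact hs

lemma diag_ne {S : Finset (Finset (Fin N))} (hS : IsDissection N S) {x y : Fin N}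
    (h : {x, y} ∈ S) : x ≠ y := by
  rintro rfl
  have := (hS.1 _ h).1
  simp at this

lemma exists_cell {S : Finset (Finset (Fin N))} (hS : IsDissection N S) (hN : 3 ≤ N)
    {x y : Fin N} (hxy : y ∈ nb S x) : ∃ c, IsCell N S c ∧ IsNext c x y := by
  classical
  have h0 := pos_self y
  have hL : 2 ≤ pos y x := by
    rcases hxy with h | h
    · rw [cyc_iff (by omega), sub_pos y] at h
      have := pos_lt y x
      split_ifs at h <;> omega
    · have hne := pos_ne (o := y) (diag_ne hS h)
      by_contra hcon
      apply (hS.1 _ h).2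
      rw [Finset.pair_comm, side_pos (by omega) y (by omega)]
      omega
  set L := pos y x with hLdef
  let c : Finset (Fin N) := Finset.univ.filter (fun z => pos y z ≤ L ∧ ∀ u v, {u, v} ∈ S →
    pos y u < pos y z → pos y z < pos y v → pos y v ≤ L → pos y u = 0 ∧ pos y v = L)
  have memc : ∀ z, z ∈ c ↔ (pos y z ≤ L ∧ ∀ u v, {u, v} ∈ S →
    pos y u < pos y z → pos y z < pos y v → pos y v ≤ L → pos y u = 0 ∧ pos y v = L) := by
    intro z; simp [c]
  have hy : y ∈ c := by
    rw [memc]; exact ⟨by omega, fun u v _ _ _ _ => by omega⟩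
  have hx : x ∈ c := by
    rw [memc]; exact ⟨by omega, fun u v _ _ _ _ => by omega⟩
  have hnext : IsNext c x y := by
    refine next_of_gt y hx hy (by omega) ?_
    intro w hw
    have := ((memc w).1 hw).1
    omega
  have claim : ∀ u ∈ c, ∀ v ∈ c, pos y u < pos y v →
      (∀ w ∈ c, pos y w ≤ pos y u ∨ pos y v ≤ pos y w) → pos y v ≠ pos y u + 1 →
      {u, v} ∈ S ∧ ¬ (pos y u = 0 ∧ pos y v = L) := by
    intro u hu v hv huv hbet hne
    have hu' := (memc u).1 hu
    have hv' := (memc v).1 hv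
    have ext : ∀ z, pos y u < pos y z → pos y z < pos y v → ∃ p q, {p, q} ∈ S ∧
        pos y p < pos y z ∧ pos y z < pos y q ∧ pos y q ≤ L ∧ ¬ (pos y p = 0 ∧ pos y q = L) := by
      intro z h1 h2
      have hz : z ∉ c := by
        intro hz
        have := hbet z hz
        omega
      rw [memc] at hz
      push Not at hz
      obtain ⟨p, q, k1, k2, k3, k4, k5⟩ := hz (by omega)
      exact ⟨p, q, k1, k2, k3, k4, fun hh => k5 hh.1 hh.2⟩
    let F : Finset (Fin N) := Finset.univ.filter (fun q => {u, q} ∈ S ∧ pos y u + 1 < pos y q ∧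
      pos y q ≤ L ∧ ¬ (pos y u = 0 ∧ pos y q = L))
    have memF : ∀ q, q ∈ F ↔ ({u, q} ∈ S ∧ pos y u + 1 < pos y q ∧
      pos y q ≤ L ∧ ¬ (pos y u = 0 ∧ pos y q = L)) := by
      intro z; simp [F]
    have hF : F.Nonempty := by
      obtain ⟨z, hz⟩ := pos_surj y (pos y u + 1) (by have := pos_lt y v; omega)
      obtain ⟨p, q, k1, k2, k3, k4, k5⟩ := ext z (by omega) (by omega)
      have : pos y p = pos y u := by
        by_contra hcon
        exact k5 (hu'.2 p q k1 (by omega) (by omega) k4)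
      have := pos_inj this
      subst this
      exact ⟨q, (memF q).2 ⟨k1, by omega, k4, k5⟩⟩
    obtain ⟨q, hq, hmax⟩ := Finset.exists_max_image F (pos y) hF
    have hq' := (memF q).1 hq
    have hqv : pos y q ≤ pos y v := by
      by_contra hcon
      exact hq'.2.2.2 (hv'.2 u q hq'.1 huv (by omega) hq'.2.2.1)
    by_cases hqe : pos y q = pos y v
    · have := pos_inj hqe
      subst this
      exact ⟨hq'.1, hq'.2.2.2⟩
    · exfalso
      obtain ⟨p, r, k1, k2, k3, k4, k5⟩ := ext q (by omega) (by omega)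
      have hpu : pos y p ≤ pos y u := by
        by_contra hcon
        exact nocross hS y hq'.1 k1 (by omega) k2 k3
      have : pos y p = pos y u := by
        by_contra hcon
        exact k5 (hu'.2 p r k1 (by omega) (by omega) k4)
      have := pos_inj this
      subst this
      have := hmax r ((memF r).2 ⟨k1, by omega, k4, k5⟩)
      omega
  refine ⟨c, ⟨?_, ?_, ?_⟩, hnext⟩
  · have : ∃ m ∈ c, pos y y < pos y m ∧ pos y m < pos y x := by
      by_contra hcon
      push Not at hcon
      have := claim y hy x hx (by omega) (by
        intro w hw
        have := hcon w hw
        omega) (by omega)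
      exact this.2 ⟨h0, rfl⟩
    obtain ⟨m, hm, m1, m2⟩ := this
    have h3 : ({y, m, x} : Finset (Fin N)).card = 3 := by
      apply Finset.card_eq_three.2
      refine ⟨y, m, x, ?_, ?_, ?_, rfl⟩ <;> rintro rfl <;> omega
    rw [← h3]
    apply Finset.card_le_card
    intro q hq
    simp only [Finset.mem_insert, Finset.mem_singleton] at hq
    rcases hq with rfl | rfl | rfl <;> assumption
  · intro u v huv
    have hne := pos_ne (o := y) huv.2.2.1
    by_cases hlt : pos y u < pos y v
    · by_cases h1 : pos y v = pos y u + 1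
      · left; rw [side_pos (by omega) y hlt]; exact Or.inl h1
      · right; exact (claim u huv.1 v huv.2.1 hlt (next_lt y huv hlt) h1).1
    · have hb := next_gt y huv (by omega)
      have e1 : v = y := by
        apply pos_inj (o := y)
        have := hb y hy
        omega
      have e2 : u = x := by
        apply pos_inj (o := y)
        have := hb x hx
        have := ((memc u).1 huv.1).1
        omega
      subst e1 e2
      rcases hxy with h | h
      · left; rw [side_iff (by omega)]; left; rwa [← cyc_iff (by omega)]
      · right; exact h
  · have key : ∀ u v, {u, v} ∈ S → u ∈ c → v ∈ c → pos y u < pos y v →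
        (IsNext c u v ∨ IsNext c v u) := by
      intro u v huv hu hv hlt
      by_cases he : pos y u = 0 ∧ pos y v = L
      · right
        refine next_of_gt y hv hu hlt ?_
        intro w hw
        have := ((memc w).1 hw).1
        omega
      · left
        refine next_of_lt y hu hv hlt ?_
        intro w hw
        by_contra hcon
        exact he (((memc w).1 hw).2 u v huv (by omega) (by omega) ((memc v).1 hv).1)
    intro e he hec
    obtain ⟨u, v, huv, rfl⟩ := Finset.card_eq_two.1 (hS.1 e he).1
    have hu : u ∈ c := hec (by simp)
    have hv : v ∈ c := hec (by simp)
    refine ⟨u, v, rfl, ?_⟩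
    rcases lt_or_gt_of_ne (pos_ne (o := y) huv) with h | h
    · exact key u v he hu hv h
    · exact (key v u (by rwa [Finset.pair_comm]) hv hu h).symm

lemma quiddity_eq {S : Finset (Finset (Fin N))} (hS : IsDissection N S) (hN : 3 ≤ N) (x : Fin N) :
    quiddity N S x = (nb S x).ncard := by
  unfold quiddity
  have H : ∀ c, ∀ hc : c ∈ {c : Finset (Fin N) | IsCell N S c ∧ x ∈ c}, ∃ y, IsNext c x y :=
    fun c hc => exists_next hc.1.1 hc.2
  choose f hf using H
  refine Set.ncard_congr f ?_ ?_ ?_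
  · intro c hc
    exact next_nb hc.1 (hf c hc)
  · intro c c' hc hc' he
    have h1 := hf c hc
    have h2 := hf c' hc'
    rw [← he] at h2
    exact Finset.Subset.antisymm (cell_sub hS hc.1 hc'.1 h1 h2) (cell_sub hS hc'.1 hc.1 h2 h1)
  · intro y hy
    obtain ⟨c, hc, hn⟩ := exists_cell hS hN hy
    exact ⟨c, ⟨hc, hn.1⟩, next_unique (hf c ⟨hc, hn.1⟩) hn⟩

lemma mem_of_nb {S : Finset (Finset (Fin N))} (hN : 3 ≤ N) {x y : Fin N} (h : y ∈ nb S x)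
    (hs : ¬ IsSide N {x, y}) : {x, y} ∈ S := by
  rcases h with h | h
  · exfalso; apply hs; rw [side_iff (by omega)]; left; rwa [← cyc_iff (by omega)]
  · exact h

lemma nb_eq {S T : Finset (Finset (Fin N))} (hS : IsDissection N S) (hT : IsDissection N T)
    (hN : 3 ≤ N) (hq : quiddity N S = quiddity N T) {x : Fin N}
    (h : ∀ y, {x, y} ∈ S → {x, y} ∈ T) : ∀ y, {x, y} ∈ T → {x, y} ∈ S := by
  have hsub : nb S x ⊆ nb T x := by
    intro y hy
    rcases hy with hy | hy
    · left; exact hy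
    · right; exact h y hy
  have he : nb S x = nb T x := by
    apply Set.eq_of_subset_of_ncard_le hsub
    rw [← quiddity_eq hS hN, ← quiddity_eq hT hN, hq]
  intro y hy
  have : y ∈ nb S x := by rw [he]; right; exact hy
  exact mem_of_nb hN this (hT.1 _ hy).2

lemma main_step {S T : Finset (Finset (Fin N))} (hS : IsDissection N S) (hT : IsDissection N T)
    (hN : 3 ≤ N) (hq : quiddity N S = quiddity N T) {k l : ℕ}
    (hk : ∀ c : Finset (Fin N), IsCell N S c → c.card = k)
    (hl : ∀ c : Finset (Fin N), IsCell N T c → c.card = l)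
    (o : Fin N) {a b : Fin N} (hab : {a, b} ∈ S) (hlt : pos o a < pos o b)
    (hind : ∀ u v, {u, v} ∈ S → pos o u < pos o v → pos o v - pos o u < pos o b - pos o a →
      {u, v} ∈ T) : k ≤ l ∧ (k = l → {a, b} ∈ T) := by
  have inS : ∀ x y, {x, y} ∈ S → pos o a < pos o x → pos o x < pos o b →
      pos o a ≤ pos o y ∧ pos o y ≤ pos o b := by
    intro x y hxy h1 h2
    constructor
    · by_contra hcon
      rw [Finset.pair_comm] at hxy
      exact nocross hS o hxy hab (by omega) h1 h2
    · by_contra hcon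
      exact nocross hS o hab hxy h1 h2 (by omega)
  have hTS : ∀ x, pos o a < pos o x → pos o x < pos o b → ∀ y, {x, y} ∈ T → {x, y} ∈ S := by
    intro x h1 h2
    apply nb_eq hS hT hN hq
    intro y hxy
    have := inS x y hxy h1 h2
    rcases lt_or_gt_of_ne (pos_ne (o := o) (diag_ne hS hxy)) with h | h
    · exact hind x y hxy h (by omega)
    · rw [Finset.pair_comm] at hxy ⊢
      exact hind y x hxy h (by omega)
  obtain ⟨c, hc, hba⟩ := exists_cell hS hN (x := b) (y := a)
    (Or.inr (by rwa [Finset.pair_comm]))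
  have hbd := next_gt o hba hlt
  obtain ⟨v, hav⟩ := exists_next hc.1 hba.2.1
  have hvb : v ≠ b := by
    rintro rfl
    have := next_next hba hav
    have := hc.1
    omega
  have hvb' := pos_ne (o := o) hvb
  have hva' := pos_ne (o := o) hav.2.2.1
  have hv := hbd v hav.2.1
  have havT : v ∈ nb T a := by
    rcases next_nb hc hav with h | h
    · left; exact h
    · right; exact hind a v h (by omega) (by omega)
  obtain ⟨c', hc', hav'⟩ := exists_cell hT hN havT
  have hmin := next_lt o hav (by omega)
  have hmin' := next_lt o hav' (by omega)
  have hsub : c ⊆ c' := by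
    intro z hz
    by_contra hz'
    have hzb := hbd z hz
    have hza : pos o z ≠ pos o a := pos_ne (by rintro rfl; exact hz' hav'.1)
    by_cases hbig : ∃ w ∈ c', pos o z ≤ pos o w
    · obtain ⟨w, hw, hzw⟩ := hbig
      obtain ⟨s, t, hst, l1, l2, hm⟩ := cell_gap hc' o hz' hav'.1 hw hzb.1 hzw
      have has : pos o a < pos o s := by
        have h1 := next_lt o hst (by omega) a hav'.1
        rcases Nat.lt_or_ge (pos o a) (pos o s) with h | h
        · exact h
        · exfalso
          have e : s = a := pos_inj (o := o) (by omega)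
          subst e
          have e := next_unique hst hav'
          subst e
          have := hmin z hz
          omega
      have hmS := hTS s has (by omega) t hm
      have := inS s t hmS has (by omega)
      have := capture hS hc o hz hmS l1 l2 hba.2.1 hba.1 (by omega) (by omega) a hba.2.1
      omega
    · push Not at hbig
      obtain ⟨s, hs, hmax⟩ := Finset.exists_max_image c' (pos o) ⟨a, hav'.1⟩
      have hsz := hbig s hs
      obtain ⟨t, hst⟩ := exists_next hc'.1 hs
      have hts : pos o t < pos o s := by
        have := hmax t hst.2.1
        have := pos_ne (o := o) hst.2.2.1
        omega
      have hmn := next_gt o hst hts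
      have hvs := hmax v hav'.2.1
      have hta := hmn a hav'.1
      have hmT : {s, t} ∈ T := by
        rcases hc'.2.1 s t hst with h | h
        · exfalso
          rw [Finset.pair_comm, side_pos (by omega) o hts] at h
          have := pos_lt o z
          have e1 : t = a := pos_inj (o := o) (by omega)
          have e2 : s = v := pos_inj (o := o) (by omega)
          subst e1 e2
          have := next_next hst hav'
          have := hc'.1
          omega
        · exact h
      have hmS := hTS s (by omega) (by omega) t hmT
      have hat := inS s t hmS (by omega) (by omega)
      have e1 : t = a := pos_inj (o := o) (by omega)
      subst e1
      have hvs' : pos o v ≠ pos o s := by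
        apply pos_ne
        rintro rfl
        have := next_next hst hav'
        have := hc'.1
        omega
      rw [Finset.pair_comm] at hmS
      have := capture hS hc o hav.2.1 hmS (by omega) (by omega) hba.2.1 hz le_rfl (by omega) z hz
      omega
  have hcard := Finset.card_le_card hsub
  rw [hk c hc, hl c' hc'] at hcard
  refine ⟨hcard, fun hkl => ?_⟩
  have he : c = c' := Finset.eq_of_subset_of_card_le hsub (by rw [hk c hc, hl c' hc', hkl])
  rw [← he] at hc'
  rcases hc'.2.1 b a hba with h | h
  · exfalso
    rw [Finset.pair_comm] at h
    exact (hS.1 _ hab).2 h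
  · rwa [Finset.pair_comm]

lemma three_le {S : Finset (Finset (Fin N))} (hS : IsDissection N S) {x y : Fin N}
    (h : {x, y} ∈ S) : 3 ≤ N := by
  have hne := diag_ne hS h
  have hx := x.isLt
  have hy := y.isLt
  have hne' : x.val ≠ y.val := fun h => hne (Fin.ext h)
  by_contra hcon
  apply (hS.1 _ h).2
  rw [side_iff (by omega), sub_val_eq, sub_val_eq]
  split_ifs <;> omega

lemma le_of_nonempty {S T : Finset (Finset (Fin N))} (hS : IsDissection N S)
    (hT : IsDissection N T)
    (hN : 3 ≤ N) (hq : quiddity N S = quiddity N T) {k l : ℕ}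
    (hk : ∀ c : Finset (Fin N), IsCell N S c → c.card = k)
    (hl : ∀ c : Finset (Fin N), IsCell N T c → c.card = l)
    (hne : S.Nonempty) : k ≤ l := by
  classical
  have o : Fin N := ⟨0, by omega⟩
  have hex : ∃ n : ℕ, ∃ u v, {u, v} ∈ S ∧ pos o u < pos o v ∧ pos o v - pos o u = n := by
    obtain ⟨e, he⟩ := hne
    obtain ⟨u, v, huv, rfl⟩ := Finset.card_eq_two.1 (hS.1 e he).1
    rcases lt_or_gt_of_ne (pos_ne (o := o) huv) with h | h
    · exact ⟨_, u, v, he, h, rfl⟩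
    · exact ⟨_, v, u, by rwa [Finset.pair_comm], h, rfl⟩
  obtain ⟨a, b, hab, hlt, hn⟩ := Nat.find_spec hex
  refine (main_step hS hT hN hq hk hl o hab hlt ?_).1
  intro u v huv h1 h2
  exact absurd ⟨u, v, huv, h1, rfl⟩ (Nat.find_min hex (by omega))

lemma sub_of_eq {S T : Finset (Finset (Fin N))} (hS : IsDissection N S)
    (hT : IsDissection N T)
    (hN : 3 ≤ N) (hq : quiddity N S = quiddity N T) {k : ℕ}
    (hk : ∀ c : Finset (Fin N), IsCell N S c → c.card = k)
    (hl : ∀ c : Finset (Fin N), IsCell N T c → c.card = k) : S ⊆ T := by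
  have o : Fin N := ⟨0, by omega⟩
  have key : ∀ n : ℕ, ∀ u v, {u, v} ∈ S → pos o u < pos o v → pos o v - pos o u = n →
      {u, v} ∈ T := by
    intro n
    induction n using Nat.strong_induction_on with
    | _ n ih =>
      intro a b hab hlt hn
      refine (main_step hS hT hN hq hk hl o hab hlt ?_).2 rfl
      intro u v huv h1 h2
      exact ih _ (by omega) u v huv h1 rfl
  intro e he
  obtain ⟨u, v, huv, rfl⟩ := Finset.card_eq_two.1 (hS.1 e he).1
  rcases lt_or_gt_of_ne (pos_ne (o := o) huv) with h | h
  · exact key _ u v he h rfl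
  · rw [Finset.pair_comm] at he ⊢
    exact key _ v u he h rfl

lemma empty_of_empty {S T : Finset (Finset (Fin N))} (hS : IsDissection N S)
    (hT : IsDissection N T) (hq : quiddity N S = quiddity N T) (he : S = ∅) : T = ∅ := by
  rw [Finset.eq_empty_iff_forall_notMem]
  intro e heT
  obtain ⟨u, v, huv, rfl⟩ := Finset.card_eq_two.1 (hT.1 e heT).1
  have := nb_eq hS hT (three_le hT heT) hq (x := u) (by simp [he]) v heT
  simp [he] at this

end aux

/-- A dissection of a convex `N`-gon all of whose cells have the same number of
vertices is determined by its quiddity. -/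
theorem quiddity_determines_equal_cell_dissection (N : ℕ)
    (S T : Finset (Finset (Fin N)))
    (hS : IsDissection N S) (hT : IsDissection N T)
    (hSeq : ∃ k, ∀ c : Finset (Fin N), IsCell N S c → c.card = k)
    (hTeq : ∃ k, ∀ c : Finset (Fin N), IsCell N T c → c.card = k)
    (hq : quiddity N S = quiddity N T) :
    S = T := by
  by_cases hSe : S = ∅
  · rw [hSe, empty_of_empty hS hT hq hSe]
  by_cases hTe : T = ∅
  · rw [hTe, empty_of_empty hT hS hq.symm hTe]
  obtain ⟨k, hk⟩ := hSeq
  obtain ⟨l, hl⟩ := hTeq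
  have hSn := Finset.nonempty_iff_ne_empty.2 hSe
  have hTn := Finset.nonempty_iff_ne_empty.2 hTe
  have hN : 3 ≤ N := by
    obtain ⟨e, he⟩ := hSn
    obtain ⟨u, v, huv, rfl⟩ := Finset.card_eq_two.1 (hS.1 e he).1
    exact three_le hS he
  have hkl : k = l := le_antisymm (le_of_nonempty hS hT hN hq hk hl hSn)
    (le_of_nonempty hT hS hN hq.symm hl hk hTn)
  subst hkl
  exact Finset.Subset.antisymm (sub_of_eq hS hT hN hq hk hl) (sub_of_eq hT hS hN hq.symm hl hk)

end PolygonDissection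
end

section
/- A triangulation of a convex N-gon is uniquely determined by its quiddity: two triangulations of the N-gon with the same quiddity are equal. -/
/-! A combinatorial model of dissections of a convex `N`-gon.
Vertices are `Fin N` in cyclic (convex position) order.  A dissection is
recorded by its set of pairwise non-crossing diagonals; its cells are the
faces of the resulting subdivision. -/

namespace PolygonDissection

/-- side or diagonal of `S`, in linear form -/
def Edg {N : ℕ} (S : Finset (Finset (Fin N))) (x y : Fin N) : Prop :=
  y.val = x.val + 1 ∨ (x.val = 0 ∧ y.val + 1 = N) ∨ ({x, y} : Finset (Fin N)) ∈ S

/-- triangulation -/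
def Tri (N : ℕ) (S : Finset (Finset (Fin N))) : Prop :=
  IsDissection N S ∧ ∀ c : Finset (Fin N), IsCell N S c → c.card = 3

lemma pair_eq_s8 {α : Type*} [DecidableEq α] {a b x y : α}
    (h : ({a, b} : Finset α) = {x, y}) : (a = x ∧ b = y) ∨ (a = y ∧ b = x) := by
  have h1 : a ∈ ({x, y} : Finset α) := by rw [← h]; simp
  have h2 : b ∈ ({x, y} : Finset α) := by rw [← h]; simp
  have h3 : x ∈ ({a, b} : Finset α) := by rw [h]; simp
  have h4 : y ∈ ({a, b} : Finset α) := by rw [h]; simp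
  simp only [Finset.mem_insert, Finset.mem_singleton] at h1 h2 h3 h4
  grind

lemma side_iff_s8 {N : ℕ} {x y : Fin N} (h : x.val < y.val) :
    IsSide N {x, y} ↔ (y.val = x.val + 1 ∨ (x.val = 0 ∧ y.val + 1 = N)) := by
  have hy := y.isLt
  constructor
  · rintro ⟨i, hi, he⟩
    have hv : (cyc i).val = if i.val + 1 = N then 0 else i.val + 1 := by
      have := i.isLt
      simp only [cyc]
      split_ifs with h
      · simp [h]
      · exact Nat.mod_eq_of_lt (by omega)
    rcases pair_eq_s8 he with ⟨rfl, rfl⟩ | ⟨rfl, rfl⟩ <;> split_ifs at hv <;> omega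
  · rintro (h1 | ⟨h1, h2⟩)
    · have : cyc x = y := by
        apply Fin.ext; simp only [cyc]; rw [← h1]; exact Nat.mod_eq_of_lt hy
      exact ⟨x, by rw [this]; intro h'; rw [← h'] at h; omega, by rw [this]⟩
    · have : cyc y = x := by
        apply Fin.ext; simp only [cyc]; rw [h2, h1]; exact Nat.mod_self _
      exact ⟨y, by rw [this]; intro h'; rw [← h'] at h; omega, by rw [this, Finset.pair_comm]⟩

lemma edg_iff {N : ℕ} {S : Finset (Finset (Fin N))} {x y : Fin N} (h : x.val < y.val) :
    Edg S x y ↔ (IsSide N {x, y} ∨ {x, y} ∈ S) := by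
  rw [side_iff_s8 h, Edg, or_assoc]

lemma mem_S {N : ℕ} {S : Finset (Finset (Fin N))} (hS : IsDissection N S) {e : Finset (Fin N)}
    (he : e ∈ S) : ∃ x y : Fin N, x.val + 2 ≤ y.val ∧ ¬ (x.val = 0 ∧ y.val + 1 = N) ∧
      e = {x, y} := by
  obtain ⟨h1, h2⟩ := hS.1 e he
  obtain ⟨x, y, hxy, rfl⟩ := Finset.card_eq_two.mp h1
  rcases lt_or_gt_of_ne hxy with h | h
  · rw [side_iff_s8 h] at h2
    exact ⟨x, y, by have : x.val < y.val := h
                    omega, by tauto, rfl⟩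
  · rw [Finset.pair_comm, side_iff_s8 h] at h2
    exact ⟨y, x, by have : y.val < x.val := h
                    omega, by tauto, Finset.pair_comm _ _⟩

lemma mem_S' {N : ℕ} {S : Finset (Finset (Fin N))} (hS : IsDissection N S) {x y : Fin N}
    (h : x.val < y.val) (he : {x, y} ∈ S) :
    x.val + 2 ≤ y.val ∧ ¬ (x.val = 0 ∧ y.val + 1 = N) := by
  have := (hS.1 _ he).2
  rw [side_iff_s8 h] at this
  constructor
  · omega
  · tauto

lemma noncross {N : ℕ} {S : Finset (Finset (Fin N))} (hS : IsDissection N S) {a b c d : Fin N}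
    (h1 : a.val < c.val) (h2 : c.val < b.val) (h3 : b.val < d.val)
    (hab : Edg S a b) (hcd : Edg S c d) : False := by
  have := d.isLt
  rcases hab with h | h | hab
  · omega
  · omega
  rcases hcd with h | h | hcd
  · omega
  · omega
  exact hS.2 _ hab _ hcd ⟨a, b, c, d, h1, h2, h3, Or.inl ⟨rfl, rfl⟩⟩

lemma sub_val {N : ℕ} (x y : Fin N) :
    (y - x).val = if x.val ≤ y.val then y.val - x.val else N + y.val - x.val := by
  have := x.isLt
  have := y.isLt
  rw [Fin.val_sub]
  split_ifs with h
  · rw [show N - x.val + y.val = (y.val - x.val) + N by omega, Nat.add_mod_right]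
    exact Nat.mod_eq_of_lt (by omega)
  · rw [Nat.mod_eq_of_lt (by omega)]; omega

lemma isNext_iff {N : ℕ} {c : Finset (Fin N)} {x y : Fin N} :
    IsNext c x y ↔ x ∈ c ∧ y ∈ c ∧ ((x.val < y.val ∧ ∀ z ∈ c, z.val ≤ x.val ∨ y.val ≤ z.val) ∨
      (y.val < x.val ∧ ∀ z ∈ c, y.val ≤ z.val ∧ z.val ≤ x.val)) := by
  unfold IsNext
  simp only [sub_val]
  have hx := x.isLt
  have hy := y.isLt
  constructor
  · rintro ⟨h1, h2, h3, h4⟩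
    refine ⟨h1, h2, ?_⟩
    have h3' : y.val ≠ x.val := fun h => h3 (Fin.ext h)
    by_cases hxy : x.val < y.val
    · left
      refine ⟨hxy, fun z hz => ?_⟩
      by_cases hzx : z = x
      · subst hzx; left; omega
      have h5 := h4 z hz hzx
      have := z.isLt
      split_ifs at h5 <;> omega
    · right
      refine ⟨by omega, fun z hz => ?_⟩
      by_cases hzx : z = x
      · subst hzx; omega
      have h5 := h4 z hz hzx
      have := z.isLt
      split_ifs at h5 <;> omega
  · rintro ⟨h1, h2, h3⟩
    refine ⟨h1, h2, by rintro rfl; omega, fun z hz hzx => ?_⟩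
    have hzx' : z.val ≠ x.val := fun h => hzx (Fin.ext h)
    have := z.isLt
    rcases h3 with ⟨h3, h4⟩ | ⟨h3, h4⟩
    · have := h4 z hz
      split_ifs <;> omega
    · have := h4 z hz
      split_ifs <;> omega

lemma tri_cell {N : ℕ} {S : Finset (Finset (Fin N))} {i k j : Fin N}
    (h1 : i.val < k.val) (h2 : k.val < j.val) (h : IsCell N S {i, k, j}) :
    Edg S i k ∧ Edg S k j ∧ Edg S i j := by
  obtain ⟨-, h, -⟩ := h
  refine ⟨(edg_iff h1).2 (h _ _ ?_), (edg_iff h2).2 (h _ _ ?_), (edg_iff (h1.trans h2)).2 ?_⟩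
  · rw [isNext_iff]; simp; omega
  · rw [isNext_iff]; simp; omega
  · rw [Finset.pair_comm]; apply h; rw [isNext_iff]; simp; omega

/-- the inner cell at an edge -/
lemma inner {N : ℕ} {S : Finset (Finset (Fin N))} (hS : Tri N S) {i j : Fin N}
    (hij : i.val + 2 ≤ j.val) (he : Edg S i j) :
    ∃ k : Fin N, i.val < k.val ∧ k.val < j.val ∧ Edg S i k ∧ Edg S k j ∧
      IsCell N S {i, k, j} := by
  classical
  obtain ⟨hD, h3⟩ := hS
  -- covering relation
  let Cov : Fin N → Fin N → Fin N → Prop := fun x p q =>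
    i.val ≤ p.val ∧ p.val < x.val ∧ x.val < q.val ∧ q.val ≤ j.val ∧ ¬ (p = i ∧ q = j) ∧
      ({p, q} : Finset (Fin N)) ∈ S
  let c : Finset (Fin N) := Finset.univ.filter fun x =>
    i.val ≤ x.val ∧ x.val ≤ j.val ∧ ∀ p q, ¬ Cov x p q
  have hc : ∀ x, x ∈ c ↔ (i.val ≤ x.val ∧ x.val ≤ j.val ∧ ∀ p q, ¬ Cov x p q) := by
    intro x; simp [c]
  have hic : i ∈ c := by
    rw [hc]; refine ⟨le_rfl, by omega, ?_⟩
    rintro p q ⟨a1, a2, -⟩; omega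
  have hjc : j ∈ c := by
    rw [hc]; refine ⟨by omega, le_rfl, ?_⟩
    rintro p q ⟨a1, a2, a3, a4, -⟩; omega
  -- maximal cover has end points in c
  have hmax : ∀ x p q, Cov x p q → ∃ p' q', Cov x p' q' ∧ p' ∈ c ∧ q' ∈ c := by
    have : ∀ d : ℕ, ∀ x p q, Cov x p q → N ≤ d + (q.val - p.val) →
        ∃ p' q', Cov x p' q' ∧ p' ∈ c ∧ q' ∈ c := by
      intro d
      induction d with
      | zero =>
        intro x p q h1 h2
        have := q.isLt
        omega
      | succ d ih =>
        intro x p q hcov hd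
        obtain ⟨a1, a2, a3, a4, a5, a6⟩ := hcov
        by_cases hp : p ∈ c
        · by_cases hq : q ∈ c
          · exact ⟨p, q, ⟨a1, a2, a3, a4, a5, a6⟩, hp, hq⟩
          · rw [hc] at hq
            push Not at hq
            obtain ⟨r, s, b1, b2, b3, b4, b5, b6⟩ := hq (by omega) (by omega)
            clear hq
            have hr : r.val ≤ p.val := by
              by_contra hr
              exact noncross hD (by omega) b2 b3 (Or.inr (Or.inr a6)) (Or.inr (Or.inr b6))
            exact ih x r s ⟨b1, by omega, by omega, b4, b5, b6⟩ (by omega)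
        · rw [hc] at hp
          push Not at hp
          obtain ⟨r, s, b1, b2, b3, b4, b5, b6⟩ := hp (by omega) (by omega)
          clear hp
          have hr : q.val ≤ s.val := by
            by_contra hr
            exact noncross hD b2 b3 (by omega) (Or.inr (Or.inr b6)) (Or.inr (Or.inr a6))
          exact ih x r s ⟨b1, by omega, by omega, b4, b5, b6⟩ (by omega)
    intro x p q h
    exact this N x p q h (by omega)
  -- consecutive vertices
  have hcons : ∀ x ∈ c, ∀ y ∈ c, x.val < y.val → (∀ z ∈ c, z.val ≤ x.val ∨ y.val ≤ z.val) →
      Edg S x y ∧ ¬ (x = i ∧ y = j) := by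
    intro x hx y hy hxy hz
    by_cases hy1 : y.val = x.val + 1
    · refine ⟨Or.inl hy1, ?_⟩
      rintro ⟨rfl, rfl⟩; omega
    have hxx := (hc x).1 hx
    have hyy := (hc y).1 hy
    have hyN := y.isLt
    let w : Fin N := ⟨x.val + 1, by omega⟩
    have hwv : w.val = x.val + 1 := rfl
    have hw : w ∉ c := by
      intro h; have := hz w h; omega
    rw [hc] at hw
    push Not at hw
    obtain ⟨p, q, hpq⟩ := hw (by omega) (by omega)
    obtain ⟨p, q, ⟨a1, a2, a3, a4, a5, a6⟩, hp, hq⟩ := hmax _ _ _ hpq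
    have e1 := hz q hq
    have e2 : p = x := by
      by_contra hne
      have : p.val ≠ x.val := fun h => hne (Fin.ext h)
      exact hxx.2.2 p q ⟨a1, by omega, by omega, a4, a5, a6⟩
    have e3 : q = y := by
      by_contra hne
      have : q.val ≠ y.val := fun h => hne (Fin.ext h)
      exact hyy.2.2 p q ⟨a1, by omega, by omega, a4, a5, a6⟩
    subst e2 e3
    exact ⟨Or.inr (Or.inr a6), a5⟩
  have hmid : ∃ k ∈ c, i.val < k.val ∧ k.val < j.val := by
    by_contra hno
    push Not at hno
    exact (hcons i hic j hjc (by omega) (fun z hz => by have := hno z hz; omega)).2 ⟨rfl, rfl⟩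
  obtain ⟨k, hkc, hik, hkj⟩ := hmid
  have hne1 : i ≠ k := by rintro rfl; omega
  have hne2 : k ≠ j := by rintro rfl; omega
  have hne3 : i ≠ j := by rintro rfl; omega
  have hsub : ({i, k, j} : Finset (Fin N)) ⊆ c := by
    intro x hx
    simp only [Finset.mem_insert, Finset.mem_singleton] at hx
    rcases hx with rfl | rfl | rfl <;> assumption
  have hcard : ({i, k, j} : Finset (Fin N)).card = 3 := Finset.card_eq_three.2 ⟨i, k, j, hne1, hne3, hne2, rfl⟩
  have hcell : IsCell N S c := by
    refine ⟨hcard ▸ Finset.card_le_card hsub, ?_, ?_⟩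
    · intro x y hxy
      rw [isNext_iff] at hxy
      obtain ⟨hx, hy, ⟨h1, h2⟩ | ⟨h1, h2⟩⟩ := hxy
      · exact (edg_iff h1).1 (hcons x hx y hy h1 h2).1
      · have hxx := (hc x).1 hx
        have hyy := (hc y).1 hy
        have hxj : x = j := Fin.ext (by have := h2 j hjc; omega)
        have hyi : y = i := Fin.ext (by have := h2 i hic; omega)
        subst hxj hyi
        rw [Finset.pair_comm]
        exact (edg_iff h1).1 he
    · intro e heS hec
      obtain ⟨x, y, hxy, -, rfl⟩ := mem_S hD heS
      have hx : x ∈ c := hec (by simp)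
      have hy : y ∈ c := hec (by simp)
      have hxx := (hc x).1 hx
      have hyy := (hc y).1 hy
      refine ⟨x, y, rfl, ?_⟩
      by_cases hh : x = i ∧ y = j
      · right
        rw [isNext_iff]
        refine ⟨hy, hx, Or.inr ⟨by omega, fun z hz => ?_⟩⟩
        have := (hc z).1 hz
        rw [hh.1, hh.2]
        exact ⟨this.1, this.2.1⟩
      · left
        rw [isNext_iff]
        refine ⟨hx, hy, Or.inl ⟨by omega, fun z hz => ?_⟩⟩
        by_contra hcon
        exact ((hc z).1 hz).2.2 x y ⟨by omega, by omega, by omega, by omega, hh, heS⟩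
  have heq : ({i, k, j} : Finset (Fin N)) = c :=
    Finset.eq_of_subset_of_card_le hsub (by rw [h3 c hcell, hcard])
  rw [← heq] at hcell
  obtain ⟨t1, t2, -⟩ := tri_cell hik hkj hcell
  exact ⟨k, hik, hkj, t1, t2, hcell⟩

lemma maximal {N : ℕ} {T : Finset (Finset (Fin N))} (hT : Tri N T) {i j : Fin N}
    (hij : i.val < j.val)
    (h : ∀ x y : Fin N, ({x, y} : Finset (Fin N)) ∈ T →
      ¬ (x.val < i.val ∧ i.val < y.val ∧ y.val < j.val) ∧
      ¬ (i.val < x.val ∧ x.val < j.val ∧ j.val < y.val)) : Edg T i j := by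
  have key : ∀ d : ℕ, ∀ p q : Fin N, q.val - p.val ≤ d → p.val ≤ i.val → j.val ≤ q.val →
      Edg T p q → Edg T i j := by
    intro d
    induction d with
    | zero => intro p q h1 h2 h3; omega
    | succ d ih =>
      intro p q h1 h2 h3 he
      by_cases hh : p = i ∧ q = j
      · obtain ⟨rfl, rfl⟩ := hh; exact he
      have hh' : p.val ≠ i.val ∨ q.val ≠ j.val := by
        by_contra hcon
        push Not at hcon
        exact hh ⟨Fin.ext hcon.1, Fin.ext hcon.2⟩
      obtain ⟨r, b1, b2, b3, b4, -⟩ := inner hT (i := p) (j := q) (by omega) he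
      have hq := q.isLt
      by_cases c1 : r.val ≤ i.val
      · exact ih r q (by omega) c1 h3 b4
      by_cases c2 : j.val ≤ r.val
      · exact ih p r (by omega) h2 c2 b3
      exfalso
      by_cases c3 : p.val < i.val
      · rcases b3 with b | b | b
        · omega
        · omega
        · exact (h p r b).1 ⟨c3, by omega, by omega⟩
      · rcases b4 with b | b | b
        · omega
        · omega
        · exact (h r q b).2 ⟨by omega, by omega, by omega⟩
  have hj := j.isLt
  exact key N ⟨0, by omega⟩ ⟨N - 1, by omega⟩ (by simp) (by simp) (by simp; omega)
    (Or.inr (Or.inl ⟨rfl, by simp; omega⟩))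

lemma quid_zero {N : ℕ} {S : Finset (Finset (Fin N))} (hS : Tri N S) (hN : 3 ≤ N)
    (o : Fin N) (ho : o.val = 0) :
    quiddity N S o = {b : Fin N | ({o, b} : Finset (Fin N)) ∈ S}.ncard + 1 := by
  classical
  let l : Fin N := ⟨N - 1, by omega⟩
  have hl : l.val = N - 1 := rfl
  have hset : {b : Fin N | 2 ≤ b.val ∧ Edg S o b} =
      insert l {b : Fin N | ({o, b} : Finset (Fin N)) ∈ S} := by
    ext b
    simp only [Set.mem_setOf_eq, Set.mem_insert_iff]
    have hb := b.isLt
    constructor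
    · rintro ⟨h1, h | h | h⟩
      · omega
      · left; exact Fin.ext (by omega)
      · right; exact h
    · rintro (rfl | h)
      · exact ⟨by omega, Or.inr (Or.inl ⟨ho, by omega⟩)⟩
      · refine ⟨?_, Or.inr (Or.inr h)⟩
        by_cases hb0 : b.val = 0
        · have : b = o := Fin.ext (by omega)
          subst this
          have := (hS.1.1 _ h).1
          simp at this
        · have := mem_S' hS.1 (by omega) h
          omega
  have hnot : l ∉ {b : Fin N | ({o, b} : Finset (Fin N)) ∈ S} := by
    intro h
    exact (mem_S' hS.1 (by omega) h).2 ⟨ho, by omega⟩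
  rw [← Set.ncard_insert_of_notMem hnot, ← hset]
  symm
  have hin : ∀ b ∈ {b : Fin N | 2 ≤ b.val ∧ Edg S o b}, ∃ a : Fin N,
      o.val < a.val ∧ a.val < b.val ∧ Edg S o a ∧ Edg S a b ∧ IsCell N S {o, a, b} := by
    rintro b ⟨h1, h2⟩
    exact inner hS (by omega) h2
  choose! a ha using hin
  refine Set.ncard_congr (fun b _ => ({o, a b, b} : Finset (Fin N))) ?_ ?_ ?_
  · intro b hb
    exact ⟨(ha b hb).2.2.2.2, by simp⟩
  · intro b b' hb hb' he
    obtain ⟨x1, x2, -⟩ := ha b hb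
    obtain ⟨y1, y2, -⟩ := ha b' hb'
    have m1 : b ∈ ({o, a b', b'} : Finset (Fin N)) := by
      have : b ∈ ({o, a b, b} : Finset (Fin N)) := by simp
      simpa only [he] using this
    have m2 : b' ∈ ({o, a b, b} : Finset (Fin N)) := by
      have : b' ∈ ({o, a b', b'} : Finset (Fin N)) := by simp
      simpa only [← he] using this
    simp only [Finset.mem_insert, Finset.mem_singleton, Fin.ext_iff] at m1 m2
    exact Fin.ext (by omega)
  · rintro c ⟨hc, hoc⟩
    have h3 := hS.2 c hc
    have : ∃ u v : Fin N, o.val < u.val ∧ u.val < v.val ∧ c = {o, u, v} := by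
      have h2 : (c.erase o).card = 2 := by rw [Finset.card_erase_of_mem hoc, h3]
      obtain ⟨u, v, huv, hh⟩ := Finset.card_eq_two.1 h2
      have hcc : c = insert o {u, v} := by rw [← hh, Finset.insert_erase hoc]
      have hu : u ∈ c.erase o := by rw [hh]; simp
      have hv : v ∈ c.erase o := by rw [hh]; simp
      have hu' := (Finset.mem_erase.1 hu).1
      have hv' := (Finset.mem_erase.1 hv).1
      rw [Ne, Fin.ext_iff] at hu' hv' huv
      rcases lt_or_gt_of_ne huv with h | h
      · exact ⟨u, v, by omega, h, hcc⟩
      · exact ⟨v, u, by omega, h, by rw [hcc, Finset.pair_comm]⟩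
    obtain ⟨u, v, h1, h2, rfl⟩ := this
    obtain ⟨t1, t2, t3⟩ := tri_cell h1 h2 hc
    have hv : v ∈ {b : Fin N | 2 ≤ b.val ∧ Edg S o b} := ⟨by omega, t3⟩
    refine ⟨v, hv, ?_⟩
    obtain ⟨s1, s2, s3, s4, -⟩ := ha v hv
    have : a v = u := by
      by_contra hne
      rw [Fin.ext_iff] at hne
      rcases lt_or_gt_of_ne hne with h | h
      · exact noncross hS.1 s1 h h2 t1 s4
      · exact noncross hS.1 h1 h s2 s3 t2
    simp only [this]

/-- rotation -/
def rot {N : ℕ} [NeZero N] (k : Fin N) (e : Finset (Fin N)) : Finset (Fin N) :=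
  e.map (Equiv.addRight k).toEmbedding

lemma rot_inj {N : ℕ} [NeZero N] (k : Fin N) : Function.Injective (rot k) :=
  Finset.map_injective _

lemma rot_pair {N : ℕ} [NeZero N] (k x y : Fin N) : rot k {x, y} = {x + k, y + k} := by
  simp [rot, Finset.map_insert]

lemma rot_rot {N : ℕ} [NeZero N] (k : Fin N) (e : Finset (Fin N)) : rot (-k) (rot k e) = e := by
  ext x; simp [rot, Finset.mem_map]

lemma rot_rot' {N : ℕ} [NeZero N] (k : Fin N) (e : Finset (Fin N)) : rot k (rot (-k) e) = e := by
  ext x; simp [rot, Finset.mem_map]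

lemma mem_rot {N : ℕ} [NeZero N] (k x : Fin N) (e : Finset (Fin N)) :
    x + k ∈ rot k e ↔ x ∈ e := by
  simp [rot]

lemma add_val {N : ℕ} (x y : Fin N) :
    (x + y).val = if x.val + y.val < N then x.val + y.val else x.val + y.val - N := by
  have := x.isLt
  have := y.isLt
  rw [Fin.val_add]
  split_ifs with h
  · exact Nat.mod_eq_of_lt h
  · rw [Nat.mod_eq_sub_mod (by omega)]
    exact Nat.mod_eq_of_lt (by omega)

lemma cyc_add {N : ℕ} [NeZero N] (k x : Fin N) : cyc (x + k) = cyc x + k := by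
  apply Fin.ext
  simp only [cyc, Fin.val_add, Nat.mod_add_mod]
  congr 1
  omega

lemma side_rot {N : ℕ} [NeZero N] (k : Fin N) {e : Finset (Fin N)} (h : IsSide N e) :
    IsSide N (rot k e) := by
  obtain ⟨i, hi, rfl⟩ := h
  refine ⟨i + k, ?_, ?_⟩
  · rw [cyc_add]; simpa using hi
  · rw [cyc_add, rot_pair]

lemma side_rot_iff {N : ℕ} [NeZero N] (k : Fin N) {e : Finset (Fin N)} :
    IsSide N (rot k e) ↔ IsSide N e :=
  ⟨fun h => by simpa [rot_rot] using side_rot (-k) h, side_rot k⟩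

lemma crosses_symm {N : ℕ} {e f : Finset (Fin N)} (h : Crosses N e f) : Crosses N f e := by
  obtain ⟨a, b, c, d, h1, h2, h3, h4⟩ := h
  exact ⟨a, b, c, d, h1, h2, h3, by tauto⟩

lemma cross_rot {N : ℕ} [NeZero N] (k : Fin N) {e f : Finset (Fin N)} (h : Crosses N e f) :
    Crosses N (rot k e) (rot k f) := by
  have main : ∀ a b c d : Fin N, a < c → c < b → b < d →
      Crosses N (rot k {a, b}) (rot k {c, d}) := by
    intro a b c d h1 h2 h3
    rw [Fin.lt_def] at h1 h2 h3
    rw [rot_pair, rot_pair]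
    have ha := add_val a k
    have hb := add_val b k
    have hc := add_val c k
    have hd := add_val d k
    have := k.isLt
    have := d.isLt
    by_cases wd : d.val + k.val < N
    · refine ⟨a + k, b + k, c + k, d + k, ?_, ?_, ?_, Or.inl ⟨rfl, rfl⟩⟩ <;> rw [Fin.lt_def] <;>
        split_ifs at * <;> omega
    by_cases wb : b.val + k.val < N
    · refine ⟨d + k, c + k, a + k, b + k, ?_, ?_, ?_,
        Or.inr ⟨rfl, Finset.pair_comm _ _⟩⟩ <;> rw [Fin.lt_def] <;>
        split_ifs at * <;> omega
    by_cases wc : c.val + k.val < N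
    · refine ⟨b + k, a + k, d + k, c + k, ?_, ?_, ?_,
        Or.inl ⟨Finset.pair_comm _ _, Finset.pair_comm _ _⟩⟩ <;> rw [Fin.lt_def] <;>
        split_ifs at * <;> omega
    by_cases wa : a.val + k.val < N
    · refine ⟨c + k, d + k, b + k, a + k, ?_, ?_, ?_,
        Or.inr ⟨Finset.pair_comm _ _, rfl⟩⟩ <;> rw [Fin.lt_def] <;>
        split_ifs at * <;> omega
    · refine ⟨a + k, b + k, c + k, d + k, ?_, ?_, ?_, Or.inl ⟨rfl, rfl⟩⟩ <;> rw [Fin.lt_def] <;>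
        split_ifs at * <;> omega
  obtain ⟨a, b, c, d, h1, h2, h3, ⟨rfl, rfl⟩ | ⟨rfl, rfl⟩⟩ := h
  · exact main a b c d h1 h2 h3
  · exact crosses_symm (main a b c d h1 h2 h3)

lemma next_rot {N : ℕ} [NeZero N] (k : Fin N) {c : Finset (Fin N)} {x y : Fin N} :
    IsNext (rot k c) (x + k) (y + k) ↔ IsNext c x y := by
  unfold IsNext
  have hs : ∀ u v : Fin N, (u + k) - (v + k) = u - v := fun u v => add_sub_add_right_eq_sub u v k
  constructor
  · rintro ⟨h1, h2, h3, h4⟩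
    refine ⟨(mem_rot _ _ _).1 h1, (mem_rot _ _ _).1 h2, fun h => h3 (by rw [h]), ?_⟩
    intro z hz hzx
    have := h4 (z + k) ((mem_rot _ _ _).2 hz) (by simpa using hzx)
    simpa only [hs] using this
  · rintro ⟨h1, h2, h3, h4⟩
    refine ⟨(mem_rot _ _ _).2 h1, (mem_rot _ _ _).2 h2, by simpa using h3, ?_⟩
    intro z hz hzx
    obtain ⟨z, rfl⟩ : ∃ w, z = w + k := ⟨z - k, by simp⟩
    have := h4 z ((mem_rot _ _ _).1 hz) (by rintro rfl; exact hzx rfl)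
    simpa only [hs] using this

lemma mem_image_rot {N : ℕ} [NeZero N] (k : Fin N) {S : Finset (Finset (Fin N))}
    {e : Finset (Fin N)} : rot k e ∈ S.image (rot k) ↔ e ∈ S := by
  simp only [Finset.mem_image]
  constructor
  · rintro ⟨f, hf, h⟩; rwa [← rot_inj k h]
  · intro h; exact ⟨e, h, rfl⟩

lemma image_rot_rot {N : ℕ} [NeZero N] (k : Fin N) (S : Finset (Finset (Fin N))) :
    (S.image (rot k)).image (rot (-k)) = S := by
  rw [Finset.image_image]
  have : rot (-k) ∘ rot k = id := by funext e; exact rot_rot k e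
  rw [this, Finset.image_id]

lemma cell_rot {N : ℕ} [NeZero N] (k : Fin N) {S : Finset (Finset (Fin N))}
    {c : Finset (Fin N)} (h : IsCell N S c) : IsCell N (S.image (rot k)) (rot k c) := by
  obtain ⟨h1, h2, h3⟩ := h
  refine ⟨by simpa [rot] using h1, ?_, ?_⟩
  · intro x y hxy
    obtain ⟨x, rfl⟩ : ∃ w, x = w + k := ⟨x - k, by simp⟩
    obtain ⟨y, rfl⟩ : ∃ w, y = w + k := ⟨y - k, by simp⟩
    rw [next_rot] at hxy
    rw [← rot_pair, side_rot_iff, mem_image_rot]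
    exact h2 x y hxy
  · intro e he hec
    obtain ⟨f, hf, rfl⟩ := Finset.mem_image.1 he
    obtain ⟨x, y, rfl, hn⟩ := h3 f hf (by simpa [rot] using hec)
    refine ⟨x + k, y + k, rot_pair _ _ _, ?_⟩
    rwa [next_rot, next_rot]

lemma cell_rot_iff {N : ℕ} [NeZero N] (k : Fin N) {S : Finset (Finset (Fin N))}
    {c : Finset (Fin N)} : IsCell N (S.image (rot k)) (rot k c) ↔ IsCell N S c :=
  ⟨fun h => by simpa only [image_rot_rot, rot_rot] using cell_rot (-k) h, cell_rot k⟩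

lemma tri_rot {N : ℕ} [NeZero N] (k : Fin N) {S : Finset (Finset (Fin N))} (h : Tri N S) :
    Tri N (S.image (rot k)) := by
  obtain ⟨⟨h1, h2⟩, h3⟩ := h
  refine ⟨⟨?_, ?_⟩, ?_⟩
  · intro e he
    obtain ⟨f, hf, rfl⟩ := Finset.mem_image.1 he
    obtain ⟨a, b⟩ := h1 f hf
    exact ⟨by simpa [rot] using a, by rwa [side_rot_iff]⟩
  · intro e he e' he' hc
    obtain ⟨f, hf, rfl⟩ := Finset.mem_image.1 he
    obtain ⟨f', hf', rfl⟩ := Finset.mem_image.1 he'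
    have := cross_rot (-k) hc
    rw [rot_rot, rot_rot] at this
    exact h2 f hf f' hf' this
  · intro c hc
    rw [← rot_rot' k c, cell_rot_iff] at hc
    simpa [rot] using h3 _ hc

lemma quid {N : ℕ} {S : Finset (Finset (Fin N))} (hS : Tri N S) (hN : 3 ≤ N) (k : Fin N) :
    quiddity N S k = {b : Fin N | ({k, b} : Finset (Fin N)) ∈ S}.ncard + 1 := by
  haveI : NeZero N := ⟨by omega⟩
  have h := quid_zero (tri_rot (-k) hS) hN 0 (by simp)
  have e1 : quiddity N (S.image (rot (-k))) 0 = quiddity N S k := by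
    unfold quiddity
    rw [← Set.ncard_image_of_injective {c : Finset (Fin N) | IsCell N S c ∧ k ∈ c} (rot_inj (-k))]
    congr 1
    ext c
    simp only [Set.mem_setOf_eq, Set.mem_image]
    have hk : (0 : Fin N) = k + -k := by simp
    constructor
    · rintro ⟨h1, h2⟩
      have hc : c = rot (-k) (rot k c) := (rot_rot k c).symm
      rw [hc] at h1 h2
      rw [cell_rot_iff] at h1
      rw [hk, mem_rot] at h2
      exact ⟨rot k c, ⟨h1, h2⟩, hc.symm⟩
    · rintro ⟨c, ⟨h1, h2⟩, rfl⟩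
      exact ⟨cell_rot _ h1, by rw [hk, mem_rot]; exact h2⟩
  have e2 : {b : Fin N | ({0, b} : Finset (Fin N)) ∈ S.image (rot (-k))}.ncard =
      {b : Fin N | ({k, b} : Finset (Fin N)) ∈ S}.ncard := by
    rw [← Set.ncard_image_of_injective {b : Fin N | ({k, b} : Finset (Fin N)) ∈ S}
      (add_left_injective (-k))]
    congr 1
    ext b
    have key : ∀ b : Fin N, ({0, b + -k} : Finset (Fin N)) ∈ S.image (rot (-k)) ↔
        ({k, b} : Finset (Fin N)) ∈ S := by
      intro b
      have : ({0, b + -k} : Finset (Fin N)) = rot (-k) {k, b} := by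
        rw [rot_pair, add_neg_cancel]
      rw [this, mem_image_rot]
    simp only [Set.mem_setOf_eq, Set.mem_image]
    constructor
    · intro hb
      refine ⟨b + k, ?_, by simp⟩
      rw [← key]; simpa using hb
    · rintro ⟨x, hx, rfl⟩
      exact (key x).2 hx
  rw [← e1, ← e2, h]

lemma key_step {N : ℕ} {S T : Finset (Finset (Fin N))} (hS : Tri N S) (hT : Tri N T)
    (hq : quiddity N S = quiddity N T) (i j : Fin N) (hij : i.val < j.val)
    (hag : ∀ x y : Fin N, x.val < y.val → y.val - x.val < j.val - i.val →
      (({x, y} : Finset (Fin N)) ∈ S ↔ ({x, y} : Finset (Fin N)) ∈ T))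
    (he : ({i, j} : Finset (Fin N)) ∈ S) : ({i, j} : Finset (Fin N)) ∈ T := by
  obtain ⟨g1, g2⟩ := mem_S' hS.1 hij he
  have hj := j.isLt
  obtain ⟨k, h1, h2, h3, h4, -⟩ := inner hS g1 (Or.inr (Or.inr he))
  have hN : 3 ≤ N := by omega
  have hk := congrFun hq k
  rw [quid hS hN, quid hT hN] at hk
  -- neighbours in `S` stay in `[i,j]`
  have hrange : ∀ x : Fin N, ({k, x} : Finset (Fin N)) ∈ S → i.val ≤ x.val ∧ x.val ≤ j.val := by
    intro x hx
    constructor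
    · by_contra hc
      rw [Finset.pair_comm] at hx
      exact noncross hS.1 (by omega) h1 h2 (Or.inr (Or.inr hx)) (Or.inr (Or.inr he))
    · by_contra hc
      exact noncross hS.1 h1 h2 (by omega) (Or.inr (Or.inr he)) (Or.inr (Or.inr hx))
  have hsub : {b : Fin N | ({k, b} : Finset (Fin N)) ∈ S} ⊆
      {b : Fin N | ({k, b} : Finset (Fin N)) ∈ T} := by
    intro x hx
    simp only [Set.mem_setOf_eq] at hx ⊢
    have hr := hrange x hx
    rcases lt_trichotomy k.val x.val with h | h | h
    · exact (hag k x h (by omega)).1 hx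
    · have : k = x := Fin.ext h
      subst this
      have := (hS.1.1 _ hx).1
      simp at this
    · rw [Finset.pair_comm] at hx ⊢
      exact (hag x k h (by omega)).1 hx
  have heq := Set.eq_of_subset_of_ncard_le hsub (by omega) (Set.toFinite _)
  have hrT : ∀ x : Fin N, ({k, x} : Finset (Fin N)) ∈ T → i.val ≤ x.val ∧ x.val ≤ j.val := by
    intro x hx
    apply hrange
    have : x ∈ {b : Fin N | ({k, b} : Finset (Fin N)) ∈ T} := hx
    rwa [← heq] at this
  have h3T : Edg T i k := by
    rcases h3 with h | h | h
    · exact Or.inl h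
    · exact Or.inr (Or.inl h)
    · exact Or.inr (Or.inr ((hag i k h1 (by omega)).1 h))
  have h4T : Edg T k j := by
    rcases h4 with h | h | h
    · exact Or.inl h
    · exact Or.inr (Or.inl h)
    · exact Or.inr (Or.inr ((hag k j h2 (by omega)).1 h))
  have hE : Edg T i j := by
    apply maximal hT hij
    intro x y hxy
    have hxy' : Edg T x y := Or.inr (Or.inr hxy)
    constructor
    · rintro ⟨a1, a2, a3⟩
      rcases lt_trichotomy y.val k.val with h | h | h
      · exact noncross hT.1 a1 a2 h hxy' h3T
      · have : y = k := Fin.ext h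
        subst this
        rw [Finset.pair_comm] at hxy
        have := hrT x hxy
        omega
      · exact noncross hT.1 (by omega) h a3 hxy' h4T
    · rintro ⟨a1, a2, a3⟩
      rcases lt_trichotomy x.val k.val with h | h | h
      · exact noncross hT.1 a1 h (by omega) h3T hxy'
      · have : x = k := Fin.ext h
        subst this
        have := hrT y hxy
        omega
      · exact noncross hT.1 h a2 a3 h4T hxy'
  rcases hE with h | h | h
  · omega
  · exact absurd h g2
  · exact h

/-- A triangulation of a convex `N`-gon is determined by its quiddity. -/
theorem quiddity_determines_triangulation (N : ℕ)
    (S T : Finset (Finset (Fin N)))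
    (hS : IsDissection N S) (hT : IsDissection N T)
    (hS3 : ∀ c : Finset (Fin N), IsCell N S c → c.card = 3)
    (hT3 : ∀ c : Finset (Fin N), IsCell N T c → c.card = 3)
    (hq : quiddity N S = quiddity N T) :
    S = T := by
  have main : ∀ d : ℕ, ∀ x y : Fin N, x.val < y.val → y.val - x.val = d →
      (({x, y} : Finset (Fin N)) ∈ S ↔ ({x, y} : Finset (Fin N)) ∈ T) := by
    intro d
    induction d using Nat.strong_induction_on with
    | _ d ih =>
      intro x y hxy hd
      constructor
      · exact key_step ⟨hS, hS3⟩ ⟨hT, hT3⟩ hq x y hxy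
          (fun u v huv hlt => ih _ (by omega) u v huv rfl)
      · exact key_step ⟨hT, hT3⟩ ⟨hS, hS3⟩ hq.symm x y hxy
          (fun u v huv hlt => (ih _ (by omega) u v huv rfl).symm)
  ext e
  constructor
  · intro he
    obtain ⟨x, y, hxy, -, rfl⟩ := mem_S hS he
    exact (main _ x y (by omega) rfl).1 he
  · intro he
    obtain ⟨x, y, hxy, -, rfl⟩ := mem_S hT he
    exact (main _ x y (by omega) rfl).2 he

end PolygonDissection
end
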